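/- Let n ≥ 3 and let Ω ⊂ ℝⁿ be a bounded strictly convex open set with smooth boundary which is rotationally symmetric about the xₙ-axis (invariant under every rotation about the xₙ-axis). Let f : ℝ → ℝ be real analytic and nondecreasing, and let u be a positive solution of the Dirichlet problem div(∇u/√(1+|∇u|²)) = f(u) in Ω, u = 0 on ∂Ω, which is real analytic in Ω and C¹ up to the closure of Ω. Then u has exactly one critical point in Ω, and this critical point is nondegenerate: there is a unique p ∈ Ω with ∇u(p) = 0, and the Hessian matrix D²u(p) is invertible. -/

import Mathlib

open Set Metric

noncomputable section

/-- The coefficients `a_{ij}(p) = (1+|p|²)^{-1/2}(δ_{ij} − pᵢpⱼ/(1+|p|²))`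
of the mean curvature operator. -/
def mcCoeff {n : ℕ} (p : EuclideanSpace ℝ (Fin n)) (i j : Fin n) : ℝ :=
  (Real.sqrt (1 + ‖p‖ ^ 2))⁻¹ * ((if i = j then 1 else 0) - p i * p j / (1 + ‖p‖ ^ 2))

/-- Second partial derivative `∂²u/∂xᵢ∂xⱼ`. -/
def hessEntry {n : ℕ} (u : EuclideanSpace ℝ (Fin n) → ℝ) (x : EuclideanSpace ℝ (Fin n))
    (i j : Fin n) : ℝ :=
  iteratedFDeriv ℝ 2 u x ![EuclideanSpace.single i 1, EuclideanSpace.single j 1]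

/-- The Hessian matrix `D²u(x)`. -/
def hessMatrix {n : ℕ} (u : EuclideanSpace ℝ (Fin n) → ℝ) (x : EuclideanSpace ℝ (Fin n)) :
    Matrix (Fin n) (Fin n) ℝ :=
  Matrix.of fun i j => hessEntry u x i j

/-- The mean curvature operator `L u = div(∇u/√(1+|∇u|²)) = Σ a_{ij}(∇u) ∂²u/∂xᵢ∂xⱼ`. -/
def meanCurv {n : ℕ} (u : EuclideanSpace ℝ (Fin n) → ℝ) (x : EuclideanSpace ℝ (Fin n)) : ℝ :=
  ∑ i, ∑ j, mcCoeff (gradient u x) i j * hessEntry u x i j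

/-- A solution of the Dirichlet problem `L u = f(u)` in `Ω`, `u = 0` on `∂Ω`:
`u ∈ C²(Ω) ∩ C(closure Ω)`. -/
def IsMCSolution {n : ℕ} (Ω : Set (EuclideanSpace ℝ (Fin n))) (f : ℝ → ℝ)
    (u : EuclideanSpace ℝ (Fin n) → ℝ) : Prop :=
  ContDiffOn ℝ 2 u Ω ∧ ContinuousOn u (closure Ω) ∧
    (∀ x ∈ Ω, meanCurv u x = f (u x)) ∧ (∀ x ∈ frontier Ω, u x = 0)

/-- `Ω` has smooth boundary: near each boundary point there is a smooth local defining
function with nonvanishing differential. -/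
def HasSmoothBoundary {n : ℕ} (Ω : Set (EuclideanSpace ℝ (Fin n))) : Prop :=
  ∀ x ∈ frontier Ω, ∃ V : Set (EuclideanSpace ℝ (Fin n)), ∃ φ : EuclideanSpace ℝ (Fin n) → ℝ,
    IsOpen V ∧ x ∈ V ∧ ContDiffOn ℝ (⊤ : ℕ∞) φ V ∧ (∀ y ∈ V, fderiv ℝ φ y ≠ 0) ∧
    (∀ y ∈ V, (y ∈ Ω ↔ φ y < 0)) ∧ (∀ y ∈ V, (y ∈ frontier Ω ↔ φ y = 0))

/-- A rotation about the `k`-th coordinate axis: a linear isometry fixing `e_k` and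
preserving the hyperplane spanned by the other coordinate vectors. -/
def IsAxisRotation {n : ℕ} (k : Fin n)
    (g : EuclideanSpace ℝ (Fin n) ≃ₗᵢ[ℝ] EuclideanSpace ℝ (Fin n)) : Prop :=
  g (EuclideanSpace.single k 1) = EuclideanSpace.single k 1 ∧
    ∀ x : EuclideanSpace ℝ (Fin n), x k = 0 → g x k = 0

section

open scoped Topology

lemma mem_Icc_of_cos_nonneg {g : ℝ → ℝ} (hg : Continuous g)
    (hcos : ∀ s ∈ Icc (0 : ℝ) 1, 0 ≤ Real.cos (g s))
    (h0 : g 0 ∈ Icc (-(Real.pi / 2)) (Real.pi / 2)) :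
    g 1 ∈ Icc (-(Real.pi / 2)) (Real.pi / 2) := by
  have hpi := Real.pi_pos
  constructor
  · by_contra! h
    have hm : max (g 1) (-Real.pi) ∈ Icc (g 1) (g 0) :=
      ⟨le_max_left _ _, max_le (h.le.trans h0.1) (by linarith [h0.1])⟩
    obtain ⟨s, hs, hgs⟩ := intermediate_value_Icc' zero_le_one hg.continuousOn hm
    have h1 := hcos s hs
    have h2 : g s < -(Real.pi / 2) := by rw [hgs]; exact max_lt h (by linarith)
    have h3 : -Real.pi ≤ g s := by rw [hgs]; exact le_max_right _ _
    rw [← Real.cos_neg] at h1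
    linarith [Real.cos_neg_of_pi_div_two_lt_of_lt (x := -g s) (by linarith) (by linarith)]
  · by_contra! h
    have hm : min (g 1) Real.pi ∈ Icc (g 0) (g 1) :=
      ⟨le_min (h0.2.trans h.le) (by linarith [h0.2]), min_le_left _ _⟩
    obtain ⟨s, hs, hgs⟩ := intermediate_value_Icc zero_le_one hg.continuousOn hm
    have h1 := hcos s hs
    have h2 : Real.pi / 2 < g s := by rw [hgs]; exact lt_min h (by linarith)
    have h3 : g s ≤ Real.pi := by rw [hgs]; exact min_le_right _ _
    linarith [Real.cos_neg_of_pi_div_two_lt_of_lt (x := g s) (by linarith) (by linarith)]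

/-- A nowhere vanishing planar map on the unit square cannot wind once around the origin along
the boundary of the square. -/
lemma exists_zero_of_boundary_signs {F : ℝ × ℝ → ℂ} (hF : Continuous F)
    (hleft : ∀ t ∈ Icc (0 : ℝ) 1, (F (0, t)).re ≤ 0)
    (hbot : ∀ s ∈ Icc (0 : ℝ) 1, 0 ≤ (F (s, 0)).re)
    (hright : ∀ t ∈ Icc (0 : ℝ) 1, (F (1, t)).im ≤ 0)
    (htop : ∀ s ∈ Icc (0 : ℝ) 1, (F (s, 1)).im ≤ 0)
    (h00 : 0 < (F (0, 0)).im) : ∃ x, F x = 0 := by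
  by_contra! hne
  have hpi := Real.pi_pos
  obtain ⟨L, ⟨hL0, hL⟩, -⟩ := Complex.isCoveringMapOn_exp.existsUnique_continuousMap_lifts
    (⟨F, hF⟩ : C(ℝ × ℝ, ℂ)) (a₀ := (0, 0)) (e₀ := Complex.log (F (0, 0)))
    (Complex.exp_log (hne _)) (fun a => hne a)
  have hexp : ∀ x, F x = Complex.exp (L x) := fun x => (congrFun hL x).symm
  have hre : ∀ x, (F x).re = Real.exp (L x).re * Real.cos (L x).im := fun x => by
    rw [hexp, Complex.exp_re]
  have him : ∀ x, (F x).im = Real.exp (L x).re * Real.sin (L x).im := fun x => by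
    rw [hexp, Complex.exp_im]
  have hLc : Continuous L := L.continuous
  have start : (L (0, 0)).im = Real.pi / 2 := by
    rw [hL0, Complex.log_im, Complex.arg_eq_pi_div_two_iff]
    exact ⟨le_antisymm (hleft 0 (by simp)) (hbot 0 (by simp)), h00⟩
  have a1 := mem_Icc_of_cos_nonneg (g := fun s => (L (s, 0)).im) (by fun_prop)
    (fun s hs => by
      have := hbot s hs
      rw [hre] at this
      exact nonneg_of_mul_nonneg_right this (Real.exp_pos _)) (by
      simp only [start]; constructor <;> linarith)
  have hs1 : ∀ t ∈ Icc (0 : ℝ) 1, Real.sin (L (1, t)).im ≤ 0 := fun t ht => by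
    have := hright t ht
    rw [him] at this
    exact nonpos_of_mul_nonpos_right this (Real.exp_pos _)
  have hs2 : ∀ t ∈ Icc (0 : ℝ) 1, Real.sin (L (t, 1)).im ≤ 0 := fun t ht => by
    have := htop t ht
    rw [him] at this
    exact nonpos_of_mul_nonpos_right this (Real.exp_pos _)
  have a2 : (L (1, 0)).im ≤ 0 := by
    by_contra! h
    have := Real.sin_pos_of_pos_of_lt_pi h (by linarith [a1.2])
    linarith [hs1 0 (by simp)]
  have a3 := mem_Icc_of_cos_nonneg (g := fun t => (L (1, t)).im + Real.pi / 2) (by fun_prop)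
    (fun t ht => by simpa [Real.cos_add_pi_div_two] using hs1 t ht)
    ⟨by linarith [a1.1], by linarith⟩
  have b1 := mem_Icc_of_cos_nonneg (g := fun t => (L (0, t)).im - Real.pi) (by fun_prop)
    (fun t ht => by
      have := hleft t ht
      rw [hre] at this
      have := nonpos_of_mul_nonpos_right this (Real.exp_pos _)
      simpa [Real.cos_sub_pi] using this)
    ⟨by linarith, by linarith⟩
  have b2 : Real.pi ≤ (L (0, 1)).im := by
    by_contra! h
    have := Real.sin_pos_of_pos_of_lt_pi (x := (L (0, 1)).im) (by linarith [b1.1]) h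
    linarith [hs2 0 (by simp)]
  have b3 := mem_Icc_of_cos_nonneg
    (g := fun t => (L (t, 1)).im - Real.pi - Real.pi / 2) (by fun_prop)
    (fun t ht => by
      have := hs2 t ht
      simp only [Real.cos_sub_pi_div_two, Real.sin_sub_pi]
      linarith)
    ⟨by linarith, by linarith [b1.2]⟩
  linarith [a3.2, b3.1]

variable {n : ℕ}

lemma hessEntry_eq (u : EuclideanSpace ℝ (Fin n) → ℝ) (x : EuclideanSpace ℝ (Fin n)) (i j : Fin n) :
    hessEntry u x i j = fderiv ℝ (fderiv ℝ u) x (EuclideanSpace.single i 1)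
      (EuclideanSpace.single j 1) := by
  simp [hessEntry, iteratedFDeriv_two_apply]

lemma sum_apply_single (p : EuclideanSpace ℝ (Fin n))
    {F : Type*} [AddCommGroup F] [Module ℝ F] [TopologicalSpace F]
    (T : EuclideanSpace ℝ (Fin n) →L[ℝ] F) : ∑ i, p i • T (EuclideanSpace.single i 1) = T p := by
  conv_rhs => rw [← (EuclideanSpace.basisFun (Fin n) ℝ).sum_repr p]
  simp [map_sum]

/-- The mean curvature operator applied to a bilinear form `Q` in place of the Hessian. -/
lemma sum_mcCoeff_mul (p : EuclideanSpace ℝ (Fin n))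
    (Q : EuclideanSpace ℝ (Fin n) →L[ℝ] EuclideanSpace ℝ (Fin n) →L[ℝ] ℝ) :
    ∑ i, ∑ j, mcCoeff p i j * Q (EuclideanSpace.single i 1) (EuclideanSpace.single j 1) =
      (Real.sqrt (1 + ‖p‖ ^ 2))⁻¹ *
        (∑ i, Q (EuclideanSpace.single i 1) (EuclideanSpace.single i 1)
          - Q p p / (1 + ‖p‖ ^ 2)) := by
  have hQ : Q p p = ∑ i, ∑ j, p i * p j *
      Q (EuclideanSpace.single i 1) (EuclideanSpace.single j 1) := by
    rw [← sum_apply_single p (Q p)]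
    have : ∀ j, Q p (EuclideanSpace.single j 1) =
        ∑ i, p i * Q (EuclideanSpace.single i 1) (EuclideanSpace.single j 1) := fun j => by
      have := congrArg (fun T => T (EuclideanSpace.single j 1)) (sum_apply_single p Q)
      simpa using this.symm
    simp_rw [this, smul_eq_mul, Finset.mul_sum]
    rw [Finset.sum_comm]
    exact Finset.sum_congr rfl fun i _ => Finset.sum_congr rfl fun j _ => by ring
  have h1 : ∀ i, Q (EuclideanSpace.single i 1) (EuclideanSpace.single i 1) =
      ∑ j, (if i = j then (1 : ℝ) else 0) *
        Q (EuclideanSpace.single i 1) (EuclideanSpace.single j 1) := fun i => by simp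
  rw [hQ, Finset.sum_congr rfl fun i _ => h1 i, Finset.sum_div, ← Finset.sum_sub_distrib,
    Finset.mul_sum]
  refine Finset.sum_congr rfl fun i _ => ?_
  rw [Finset.sum_div, ← Finset.sum_sub_distrib, Finset.mul_sum]
  refine Finset.sum_congr rfl fun j _ => ?_
  rw [mcCoeff]
  ring

lemma sum_mcCoeff_mul_nonpos (p : EuclideanSpace ℝ (Fin n))
    (Q : EuclideanSpace ℝ (Fin n) →L[ℝ] EuclideanSpace ℝ (Fin n) →L[ℝ] ℝ)
    (hQ : ∀ y, Q y y ≤ 0) :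
    ∑ i, ∑ j, mcCoeff p i j * Q (EuclideanSpace.single i 1) (EuclideanSpace.single j 1) ≤ 0 := by
  rw [sum_mcCoeff_mul]
  refine mul_nonpos_of_nonneg_of_nonpos (by positivity) ?_
  set s := Real.sqrt (1 + ‖p‖ ^ 2) with hs
  have hs2 : s ^ 2 = 1 + ‖p‖ ^ 2 := Real.sq_sqrt (by positivity)
  have hs0 : 0 < s := Real.sqrt_pos.2 (by positivity)
  set κ := 1 / (s * (s + 1)) with hκ
  have key : ∑ i, Q (EuclideanSpace.single i 1 - (κ * p i) • p)
      (EuclideanSpace.single i 1 - (κ * p i) • p) =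
      ∑ i, Q (EuclideanSpace.single i 1) (EuclideanSpace.single i 1)
        - Q p p / (1 + ‖p‖ ^ 2) := by
    have e1 : ∑ i, p i * Q (EuclideanSpace.single i 1) p = Q p p := by
      have := congrArg (fun T => T p) (sum_apply_single p Q)
      simpa using this
    have e2 : ∑ i, p i * Q p (EuclideanSpace.single i 1) = Q p p := by
      simpa using sum_apply_single p (Q p)
    have e3 : ∑ i, p i * p i = s ^ 2 - 1 := by
      rw [hs2, EuclideanSpace.real_norm_sq_eq]
      simp [sq]
    have : ∀ i, Q (EuclideanSpace.single i 1 - (κ * p i) • p)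
        (EuclideanSpace.single i 1 - (κ * p i) • p) =
        Q (EuclideanSpace.single i 1) (EuclideanSpace.single i 1)
          - κ * (p i * Q (EuclideanSpace.single i 1) p)
          - κ * (p i * Q p (EuclideanSpace.single i 1)) + κ ^ 2 * Q p p * (p i * p i) := fun i => by
      simp only [map_sub, map_smul, sub_apply, smul_apply,
        smul_eq_mul]
      ring
    simp_rw [this]
    rw [Finset.sum_add_distrib, Finset.sum_sub_distrib, Finset.sum_sub_distrib, ← Finset.mul_sum,
      ← Finset.mul_sum, ← Finset.mul_sum, e1, e2, e3, ← hs2, hκ]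
    field_simp
    ring
  rw [← key]
  exact Finset.sum_nonpos fun i _ => hQ _

lemma le_sum_mcCoeff_sq (p : EuclideanSpace ℝ (Fin n)) {ρ : ℝ} (hp : ‖p‖ ≤ ρ) (i₀ : Fin n) :
    ((Real.sqrt (1 + ρ ^ 2))⁻¹) ^ 3 ≤
    ∑ i, ∑ j, mcCoeff p i j * ((EuclideanSpace.single i 1 : EuclideanSpace ℝ (Fin n)) i₀ *
      (EuclideanSpace.single j 1 : EuclideanSpace ℝ (Fin n)) i₀) := by
  have hρ : 0 ≤ ρ := (norm_nonneg p).trans hp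
  have : ∑ i, ∑ j, mcCoeff p i j * ((EuclideanSpace.single i 1 : EuclideanSpace ℝ (Fin n)) i₀ *
      (EuclideanSpace.single j 1 : EuclideanSpace ℝ (Fin n)) i₀) = mcCoeff p i₀ i₀ := by
    rw [Finset.sum_eq_single i₀, Finset.sum_eq_single i₀]
    · simp
    · intro j _ hj; simp [hj.symm]
    · simp
    · intro i _ hi; simp [hi.symm]
    · simp
  rw [this, mcCoeff]
  have hpi : p i₀ ^ 2 ≤ ‖p‖ ^ 2 := by
    rw [EuclideanSpace.real_norm_sq_eq]
    exact Finset.single_le_sum (f := fun i => p i ^ 2) (fun i _ => sq_nonneg _)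
      (Finset.mem_univ i₀)
  have hs : (Real.sqrt (1 + ‖p‖ ^ 2)) ^ 2 = 1 + ‖p‖ ^ 2 := Real.sq_sqrt (by positivity)
  have hs0 : 0 < Real.sqrt (1 + ‖p‖ ^ 2) := Real.sqrt_pos.2 (by positivity)
  have hle : (Real.sqrt (1 + ρ ^ 2))⁻¹ ≤ (Real.sqrt (1 + ‖p‖ ^ 2))⁻¹ := by
    gcongr
  have h1 : ((Real.sqrt (1 + ‖p‖ ^ 2))⁻¹) ^ 2 ≤ (if i₀ = i₀ then (1 : ℝ) else 0)
      - p i₀ * p i₀ / (1 + ‖p‖ ^ 2) := by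
    rw [if_pos rfl, inv_pow, hs, le_sub_iff_add_le, inv_eq_one_div, ← add_div]
    rw [div_le_one (by positivity)]
    nlinarith
  calc _ ≤ ((Real.sqrt (1 + ‖p‖ ^ 2))⁻¹) ^ 3 := by gcongr
    _ = (Real.sqrt (1 + ‖p‖ ^ 2))⁻¹ * ((Real.sqrt (1 + ‖p‖ ^ 2))⁻¹) ^ 2 := by ring
    _ ≤ _ := by gcongr

section SecondDerivative

variable {F : Type*} [NormedAddCommGroup F] [NormedSpace ℝ F]

lemma eventually_deriv_line {w : F → ℝ} {x : F} (hw : ContDiffAt ℝ 2 w x) (y : F) :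
    ∀ᶠ t in 𝓝 (0 : ℝ), HasDerivAt (fun t : ℝ => w (x + t • y)) (fderiv ℝ w (x + t • y) y) t := by
  have hev : ∀ᶠ z in 𝓝 x, DifferentiableAt ℝ w z :=
    (hw.eventually (by simp)).mono fun z hz => hz.differentiableAt (by simp)
  have hc : Filter.Tendsto (fun t : ℝ => x + t • y) (𝓝 0) (𝓝 x) := by
    have : Continuous (fun t : ℝ => x + t • y) := by fun_prop
    simpa using this.tendsto 0
  filter_upwards [hc.eventually hev] with t ht
  have h1 : HasDerivAt (fun t : ℝ => x + t • y) y t := by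
    simpa using ((hasDerivAt_id t).smul_const y).const_add x
  exact ht.hasFDerivAt.comp_hasDerivAt t h1

lemma hasDerivAt_fderiv_line {w : F → ℝ} {x : F} (hw : ContDiffAt ℝ 2 w x) (y : F) :
    HasDerivAt (fun t : ℝ => fderiv ℝ w (x + t • y) y) (fderiv ℝ (fderiv ℝ w) x y y) 0 := by
  have h1 : HasDerivAt (fun t : ℝ => x + t • y) y 0 := by
    simpa using ((hasDerivAt_id (0 : ℝ)).smul_const y).const_add x
  have h2 : DifferentiableAt ℝ (fderiv ℝ w) x :=
    (hw.fderiv_right (m := 1) (by norm_num)).differentiableAt (by simp)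
  have h3 : HasFDerivAt (fderiv ℝ w) (fderiv ℝ (fderiv ℝ w) x) (x + (0 : ℝ) • y) := by
    simpa using h2.hasFDerivAt
  have h4 := h3.comp_hasDerivAt (0 : ℝ) h1
  simpa using h4.clm_apply (hasDerivAt_const (0 : ℝ) y)

lemma deriv_deriv_line {w : F → ℝ} {x : F} (hw : ContDiffAt ℝ 2 w x) (y : F) :
    deriv (deriv fun t : ℝ => w (x + t • y)) 0 = fderiv ℝ (fderiv ℝ w) x y y := by
  have : deriv (fun t : ℝ => w (x + t • y)) =ᶠ[𝓝 0] fun t => fderiv ℝ w (x + t • y) y :=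
    (eventually_deriv_line hw y).mono fun t ht => ht.deriv
  rw [this.deriv_eq, (hasDerivAt_fderiv_line hw y).deriv]

lemma IsLocalMax.fderiv_fderiv_nonpos {w : F → ℝ} {x : F} (hw : ContDiffAt ℝ 2 w x)
    (hmax : IsLocalMax w x) (y : F) : fderiv ℝ (fderiv ℝ w) x y y ≤ 0 := by
  by_contra! h
  have hc : Continuous (fun t : ℝ => x + t • y) := by fun_prop
  have hmax' : IsLocalMax (fun t : ℝ => w (x + t • y)) 0 := by
    have ht : Filter.Tendsto (fun t : ℝ => x + t • y) (𝓝 0) (𝓝 x) := by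
      simpa using hc.tendsto 0
    have := ht.eventually hmax
    simpa [IsLocalMax, IsMaxFilter] using this
  have hmin : IsLocalMin (fun t : ℝ => w (x + t • y)) 0 := by
    refine isLocalMin_of_deriv_deriv_pos ?_ hmax'.deriv_eq_zero ?_
    · rw [deriv_deriv_line hw y]; exact h
    · exact (eventually_deriv_line hw y).self_of_nhds.continuousAt
  have heq : (fun t : ℝ => w (x + t • y)) =ᶠ[𝓝 0] fun _ => w (x + (0 : ℝ) • y) := by
    filter_upwards [hmax', hmin] with t h1 h2
    exact le_antisymm h1 h2
  have := deriv_deriv_line hw y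
  rw [heq.deriv.deriv_eq] at this
  simp at this
  linarith

end SecondDerivative

lemma IsLocalMax.sum_mcCoeff_mul_hessEntry_add_nonpos {w φ : EuclideanSpace ℝ (Fin n) → ℝ}
    {x : EuclideanSpace ℝ (Fin n)}
    (hw : ContDiffAt ℝ 2 w x) (hφ : ContDiffAt ℝ 2 φ x)
    (hmax : IsLocalMax (fun y => w y + φ y) x) (p : EuclideanSpace ℝ (Fin n)) :
    ∑ i, ∑ j, mcCoeff p i j * hessEntry w x i j +
      ∑ i, ∑ j, mcCoeff p i j * hessEntry φ x i j ≤ 0 := by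
  have h := sum_mcCoeff_mul_nonpos p _ (IsLocalMax.fderiv_fderiv_nonpos (hw.add hφ) hmax)
  refine le_trans (le_of_eq ?_) h
  rw [← Finset.sum_add_distrib]
  refine Finset.sum_congr rfl fun i _ => ?_
  rw [← Finset.sum_add_distrib]
  refine Finset.sum_congr rfl fun j _ => ?_
  rw [← mul_add]
  congr 1
  rw [hessEntry_eq, hessEntry_eq]
  have h1 : fderiv ℝ (fun x => w x + φ x) =ᶠ[𝓝 x] fun y => fderiv ℝ w y + fderiv ℝ φ y := by
    filter_upwards [hw.eventually (by simp), hφ.eventually (by simp)] with y h1 h2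
    exact fderiv_fun_add (h1.differentiableAt (by simp)) (h2.differentiableAt (by simp))
  have hd : ∀ {g : EuclideanSpace ℝ (Fin n) → ℝ}, ContDiffAt ℝ 2 g x →
      DifferentiableAt ℝ (fderiv ℝ g) x :=
    fun hg => (hg.fderiv_right (m := 1) (by norm_num)).differentiableAt (by simp)
  rw [h1.fderiv_eq, fderiv_fun_add (hd hw) (hd hφ)]
  simp

lemma hasFDerivAt_exp_coord (a l : ℝ) (i₀ : Fin n) (x : EuclideanSpace ℝ (Fin n)) :
    HasFDerivAt (fun y : EuclideanSpace ℝ (Fin n) => a * Real.exp (l * y i₀))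
      ((a * l * Real.exp (l * x i₀)) • (EuclideanSpace.proj i₀ : EuclideanSpace ℝ (Fin n) →L[ℝ] ℝ))
          x := by
  have h1 : HasFDerivAt (fun y : EuclideanSpace ℝ (Fin n) => y i₀)
      (EuclideanSpace.proj i₀ : EuclideanSpace ℝ (Fin n) →L[ℝ] ℝ) x :=
    (EuclideanSpace.proj i₀ : EuclideanSpace ℝ (Fin n) →L[ℝ] ℝ).hasFDerivAt
  have := ((h1.const_mul l).exp).const_mul a
  refine this.congr_fderiv ?_
  rw [smul_smul, smul_smul]
  congr 1
  ring

lemma hessEntry_exp_coord (a l : ℝ) (i₀ : Fin n) (x : EuclideanSpace ℝ (Fin n)) (i j : Fin n) :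
    hessEntry (fun y : EuclideanSpace ℝ (Fin n) => a * Real.exp (l * y i₀)) x i j =
      a * l ^ 2 * Real.exp (l * x i₀) * ((EuclideanSpace.single i 1 : EuclideanSpace ℝ (Fin n)) i₀ *
      (EuclideanSpace.single j 1 : EuclideanSpace ℝ (Fin n)) i₀) := by
  rw [hessEntry_eq]
  have h1 : fderiv ℝ (fun y : EuclideanSpace ℝ (Fin n) => a * Real.exp (l * y i₀)) =
      fun x => (a * l * Real.exp (l * x i₀)) •
          (EuclideanSpace.proj i₀ : EuclideanSpace ℝ (Fin n) →L[ℝ] ℝ) :=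
    funext fun x => (hasFDerivAt_exp_coord a l i₀ x).fderiv
  rw [h1, ((hasFDerivAt_exp_coord (a * l) l i₀ x).smul_const
    (EuclideanSpace.proj i₀ : EuclideanSpace ℝ (Fin n) →L[ℝ] ℝ)).fderiv]
  simp only [ContinuousLinearMap.smulRight_apply, smul_apply, smul_eq_mul, PiLp.proj_apply]
  ring

/-- Weak maximum principle for the linear operators `∑ a_{ij}(P) ∂ᵢ∂ⱼ` with locally bounded first
order terms; the differential inequality is only needed where `w` is positive. -/
theorem weak_maximum_principle (i₀ : Fin n) {U : Set (EuclideanSpace ℝ (Fin n))} (hU : IsOpen U)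
    (hb : Bornology.IsBounded U) {w : EuclideanSpace ℝ (Fin n) → ℝ}
    {P : EuclideanSpace ℝ (Fin n) → EuclideanSpace ℝ (Fin n)}
    (hwc : ContinuousOn w (closure U)) (hw2 : ∀ x ∈ U, ContDiffAt ℝ 2 w x)
    (hbd : ∀ x ∈ frontier U, w x ≤ 0) (hP : ContinuousOn P U)
    (hineq : ∀ x ∈ U, ∃ C : ℝ, ∀ᶠ y in 𝓝 x, 0 < w y →
      -(C * ‖fderiv ℝ w y‖) ≤ ∑ i, ∑ j, mcCoeff (P y) i j * hessEntry w y i j) :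
    ∀ x ∈ U, w x ≤ 0 := by
  by_contra! hcon
  obtain ⟨x₀, hx₀, hpos⟩ := hcon
  have hcomp : IsCompact (closure U) := hb.isCompact_closure
  obtain ⟨xm, hxm, hmax⟩ := hcomp.exists_isMaxOn ⟨x₀, subset_closure hx₀⟩ hwc
  have hM : 0 < w xm := hpos.trans_le (hmax (subset_closure hx₀))
  have hUint : ∀ x ∈ closure U, 0 < w x → x ∈ U := fun x hx hx0 => by
    by_contra hxU
    exact absurd (hbd x ⟨hx, by rwa [hU.interior_eq]⟩) (not_le.2 hx0)
  have hwcU : ContinuousOn w U := hwc.mono subset_closure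
  set U' := U ∩ w ⁻¹' Ioi 0 with hU'
  have hU'o : IsOpen U' := hwcU.isOpen_inter_preimage hU isOpen_Ioi
  set K := closure U ∩ w ⁻¹' {w xm} with hK
  have hKc : IsCompact K := hcomp.of_isClosed_subset
    (hwc.preimage_isClosed_of_isClosed isClosed_closure isClosed_singleton) inter_subset_left
  have hKU : K ⊆ U' := fun x hx => by
    have h1 : w x = w xm := hx.2
    exact ⟨hUint x hx.1 (h1 ▸ hM), by simpa [h1] using hM⟩
  obtain ⟨K', hK'c, hKK', hK'U⟩ := exists_compact_between hKc hU'o hKU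
  have hK'U1 : K' ⊆ U := hK'U.trans inter_subset_left
  -- uniform bounds on the compact neighbourhood
  obtain ⟨C, hC0, hC⟩ : ∃ C : ℝ, 0 ≤ C ∧ ∀ y ∈ K', 0 < w y →
      -(C * ‖fderiv ℝ w y‖) ≤ ∑ i, ∑ j, mcCoeff (P y) i j * hessEntry w y i j := by
    refine hK'c.induction_on (p := fun s => ∃ C : ℝ, 0 ≤ C ∧ ∀ y ∈ s, 0 < w y →
      -(C * ‖fderiv ℝ w y‖) ≤ ∑ i, ∑ j, mcCoeff (P y) i j * hessEntry w y i j)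
      ⟨0, le_rfl, by simp⟩ ?_ ?_ ?_
    · rintro s t hst ⟨C, h0, hC⟩
      exact ⟨C, h0, fun y hy => hC y (hst hy)⟩
    · rintro s t ⟨C, h0, hC⟩ ⟨C', h0', hC'⟩
      refine ⟨max C C', h0.trans (le_max_left _ _), fun y hy hwy => ?_⟩
      rcases hy with hy | hy
      · refine le_trans ?_ (hC y hy hwy)
        gcongr
        exact le_max_left _ _
      · refine le_trans ?_ (hC' y hy hwy)
        gcongr
        exact le_max_right _ _
    · intro x hx
      obtain ⟨C, hC⟩ := hineq x (hK'U1 hx)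
      refine ⟨_, mem_nhdsWithin_of_mem_nhds hC, max C 0, le_max_right _ _, fun y hy hwy => ?_⟩
      refine le_trans ?_ (hy hwy)
      gcongr
      exact le_max_left _ _
  obtain ⟨ρ, hρ⟩ := hK'c.exists_bound_of_continuousOn (hP.mono hK'U1)
  set κ := ((Real.sqrt (1 + ρ ^ 2))⁻¹) ^ 3 with hκ
  have hκ0 : 0 < κ := by positivity
  set l := (C * ‖(EuclideanSpace.proj i₀ : EuclideanSpace ℝ (Fin n) →L[ℝ] ℝ)‖ + 1) / κ with hl
  have hl0 : 0 < l := by positivity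
  obtain ⟨B, hB⟩ := hK'c.exists_bound_of_continuousOn
    (f := fun y : EuclideanSpace ℝ (Fin n) => Real.exp (l * y i₀)) (by fun_prop)
  have hxmK : xm ∈ K := ⟨hxm, rfl⟩
  have hxmK' : xm ∈ K' := interior_subset (hKK' hxmK)
  have hB0 : 0 < B := (Real.exp_pos _).trans_le ((le_abs_self _).trans (hB xm hxmK'))
  obtain ⟨η, hη0, hη⟩ : ∃ η > 0, ∀ y ∈ K' \ interior K', w y ≤ w xm - η := by
    have hc : IsCompact (K' \ interior K') := hK'c.diff isOpen_interior
    rcases (K' \ interior K').eq_empty_or_nonempty with he | hne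
    · exact ⟨1, one_pos, by simp [he]⟩
    · obtain ⟨z, hz, hzmax⟩ := hc.exists_isMaxOn hne
        (hwcU.mono (sdiff_subset.trans hK'U1))
      refine ⟨w xm - w z, ?_, fun y hy => by linarith [show w y ≤ w z from hzmax hy]⟩
      have h1 : w z ≤ w xm := hmax (subset_closure (hK'U1 hz.1))
      have h2 : w z ≠ w xm := fun h =>
        hz.2 (hKK' ⟨subset_closure (hK'U1 hz.1), h⟩)
      exact sub_pos.2 (lt_of_le_of_ne h1 h2)
  set ε := η / (2 * B) with hε
  have hε0 : 0 < ε := by positivity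
  set φ := fun y : EuclideanSpace ℝ (Fin n) => ε * Real.exp (l * y i₀) with hφ
  have hφ2 : ContDiff ℝ 2 φ := by
    have : ContDiff ℝ 2 (fun y : EuclideanSpace ℝ (Fin n) => y i₀) :=
      (EuclideanSpace.proj i₀ : EuclideanSpace ℝ (Fin n) →L[ℝ] ℝ).contDiff
    fun_prop
  obtain ⟨x₁, hx₁, hx₁max⟩ := hK'c.exists_isMaxOn (f := fun y => w y + φ y) ⟨xm, hxmK'⟩
    ((hwcU.mono hK'U1).add hφ2.continuous.continuousOn)
  have hgt : w xm < w x₁ + φ x₁ := by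
    have h1 : w xm + φ xm ≤ w x₁ + φ x₁ := hx₁max hxmK'
    have : 0 < φ xm := by simp only [hφ]; positivity
    linarith
  have hx₁int : x₁ ∈ interior K' := by
    by_contra hni
    have h1 := hη x₁ ⟨hx₁, hni⟩
    have h2 : φ x₁ ≤ ε * B := by
      simp only [hφ]
      gcongr
      exact (le_abs_self _).trans (hB x₁ hx₁)
    have h3 : ε * B = η / 2 := by rw [hε]; field_simp
    linarith
  have hloc : IsLocalMax (fun y => w y + φ y) x₁ :=
    hx₁max.isLocalMax (mem_interior_iff_mem_nhds.1 hx₁int)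
  have hw₁ := hw2 x₁ (hK'U1 hx₁)
  have htest := hloc.sum_mcCoeff_mul_hessEntry_add_nonpos hw₁ hφ2.contDiffAt (P x₁)
  have hgrad : fderiv ℝ w x₁ = -((ε * l * Real.exp (l * x₁ i₀)) •
      (EuclideanSpace.proj i₀ : EuclideanSpace ℝ (Fin n) →L[ℝ] ℝ)) := by
    have h0 := hloc.fderiv_eq_zero
    rw [fderiv_fun_add (hw₁.differentiableAt (by simp)) (hφ2.contDiffAt.differentiableAt (by simp)),
      (hasFDerivAt_exp_coord ε l i₀ x₁).fderiv] at h0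
    exact eq_neg_of_add_eq_zero_left h0
  have hlow := hC x₁ hx₁ (hK'U hx₁).2
  rw [hgrad, norm_neg, norm_smul, Real.norm_of_nonneg (by positivity)] at hlow
  have hell := le_sum_mcCoeff_sq (P x₁) (hρ x₁ hx₁) i₀
  have hsum : ∑ i, ∑ j, mcCoeff (P x₁) i j * hessEntry φ x₁ i j =
      ε * l ^ 2 * Real.exp (l * x₁ i₀) * ∑ i, ∑ j, mcCoeff (P x₁) i j *
        ((EuclideanSpace.single i 1 : EuclideanSpace ℝ (Fin n)) i₀ *
            (EuclideanSpace.single j 1 : EuclideanSpace ℝ (Fin n)) i₀) := by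
    simp_rw [Finset.mul_sum, hφ, hessEntry_exp_coord]
    exact Finset.sum_congr rfl fun i _ => Finset.sum_congr rfl fun j _ => by ring
  rw [hsum] at htest
  have hkey : ε * l ^ 2 * Real.exp (l * x₁ i₀) * κ ≤
      C * (ε * l * Real.exp (l * x₁ i₀) *
          ‖(EuclideanSpace.proj i₀ : EuclideanSpace ℝ (Fin n) →L[ℝ] ℝ)‖) := by
    have : ε * l ^ 2 * Real.exp (l * x₁ i₀) * κ ≤ ε * l ^ 2 * Real.exp (l * x₁ i₀) * _ :=
      mul_le_mul_of_nonneg_left hell (by positivity)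
    linarith
  have hlκ : l * κ = C * ‖(EuclideanSpace.proj i₀ : EuclideanSpace ℝ (Fin n) →L[ℝ] ℝ)‖ + 1 := by
    rw [hl]; field_simp
  have hpos' : 0 < ε * l * Real.exp (l * x₁ i₀) := by positivity
  nlinarith [hkey, hlκ]

/-- The leading homogeneous term of an analytic function vanishing to second order. -/
lemma AnalyticAt.exists_leading_term {F : Type*} [NormedAddCommGroup F] [NormedSpace ℝ F]
    {w : F → ℝ} {p : F} (hw : AnalyticAt ℝ w p) (h0 : w p = 0) (h1 : fderiv ℝ w p = 0)
    (hne : ¬ ∀ᶠ y in 𝓝 p, w y = 0) :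
    ∃ m : ℕ, 2 ≤ m ∧ ∃ H : F → ℝ, Continuous H ∧ (∀ (t : ℝ) (y : F), H (t • y) = t ^ m * H y) ∧
      (∃ y, H y ≠ 0) ∧ ∃ C r : ℝ, 0 ≤ C ∧ 0 < r ∧
        ∀ y, ‖y‖ < r → |w (p + y) - H y| ≤ C * ‖y‖ ^ (m + 1) := by
  classical
  obtain ⟨q, hq⟩ := hw
  have hex : ∃ m, ∃ y, q m (fun _ => y) ≠ 0 := by
    by_contra! hall
    refine hne ?_
    have hc : Filter.Tendsto (fun y => y - p) (𝓝 p) (𝓝 0) := by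
      have : Continuous fun y : F => y - p := by fun_prop
      simpa using this.tendsto p
    filter_upwards [hc.eventually hq.eventually_hasSum] with y hy
    simp only [hall, add_sub_cancel] at hy
    exact (hasSum_zero.unique hy).symm
  set m := Nat.find hex with hm
  have hmin : ∀ j < m, ∀ y, q j (fun _ => y) = 0 := fun j hj y => by
    have := Nat.find_min hex hj
    push Not at this
    exact this y
  have hspec := Nat.find_spec hex
  refine ⟨m, ?_, fun y => q m (fun _ => y), ?_, ?_, hspec, ?_⟩
  · by_contra! hlt
    obtain ⟨y, hy⟩ := hspec
    rw [← hm] at hy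
    generalize m = m' at hlt hy
    interval_cases m'
    · exact hy ((hq.coeff_zero _).trans h0)
    · refine hy ?_
      have h2 := hq.fderiv_eq
      rw [h1] at h2
      have h3 := congrArg (fun T => T y) h2
      rw [continuousMultilinearCurryFin1_apply] at h3
      simp only [zero_apply] at h3
      rw [h3]
      congr 1
  · exact (q m).cont.comp (by fun_prop)
  · intro t y
    have := (q m).map_smul_univ (fun _ => t) (fun _ => y)
    simpa using this
  · have hO := hq.isBigO_sub_partialSum_pow (m + 1)
    obtain ⟨C, hC⟩ := hO.bound
    obtain ⟨r, hr, hrC⟩ := Metric.eventually_nhds_iff.1 hC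
    refine ⟨max C 0, r, le_max_right _ _, hr, fun y hy => ?_⟩
    have h2 := hrC (y := y) (by simpa using hy)
    have h3 : q.partialSum (m + 1) y = q m (fun _ => y) := by
      rw [FormalMultilinearSeries.partialSum, Finset.sum_range_succ,
        Finset.sum_eq_zero (fun j hj => hmin j (Finset.mem_range.1 hj) y), zero_add]
    rw [h3, Real.norm_eq_abs, Real.norm_of_nonneg (by positivity)] at h2
    refine h2.trans ?_
    gcongr
    exact le_max_left _ _

lemma exists_pos_of_homogeneous {F : Type*} [NormedAddCommGroup F] [InnerProductSpace ℝ F]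
    {H : F → ℝ} {m : ℕ} (hc : Continuous H) (hh : ∀ (t : ℝ) (y : F), H (t • y) = t ^ m * H y)
    (hne : ∃ y, H y ≠ 0) {ν : F} (hν : ν ≠ 0) (hnn : ∀ y, 0 < inner ℝ y ν → 0 ≤ H y) :
    ∃ y, inner ℝ y ν = 1 ∧ 0 < H y := by
  obtain ⟨y, hy⟩ := hne
  obtain ⟨z, hz, hzH⟩ : ∃ z, inner ℝ z ν ≠ 0 ∧ H z ≠ 0 := by
    by_cases hyν : inner ℝ y ν = 0
    · have h1 : Continuous fun t : ℝ => H (y + t • ν) := by fun_prop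
      have h2 : ∀ᶠ t in 𝓝 (0 : ℝ), H (y + t • ν) ≠ 0 :=
        h1.continuousAt.eventually_ne (by simpa using hy)
      obtain ⟨t, ht, ht0⟩ := ((h2.filter_mono nhdsWithin_le_nhds).and
        (self_mem_nhdsWithin : {(0 : ℝ)}ᶜ ∈ 𝓝[≠] (0 : ℝ))).exists
      refine ⟨y + t • ν, ?_, ht⟩
      rw [inner_add_left, hyν, inner_smul_left, zero_add]
      simpa [hν] using ht0
    · exact ⟨y, hyν, hy⟩
  refine ⟨(inner ℝ z ν)⁻¹ • z, ?_, ?_⟩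
  · rw [inner_smul_left]
    simp [hz]
  · refine lt_of_le_of_ne (hnn _ ?_) ?_
    · rw [inner_smul_left]
      simp [hz]
    · rw [hh]
      exact (mul_ne_zero (pow_ne_zero _ (inv_ne_zero hz)) hzH).symm

lemma contDiff_mcCoeff {m : WithTop ℕ∞} (i j : Fin n) :
    ContDiff ℝ m (fun p : EuclideanSpace ℝ (Fin n) => mcCoeff p i j) := by
  have hc : ∀ l : Fin n, ContDiff ℝ m (fun y : EuclideanSpace ℝ (Fin n) => y l) := fun l =>
    (EuclideanSpace.proj l : EuclideanSpace ℝ (Fin n) →L[ℝ] ℝ).contDiff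
  have h1 : ContDiff ℝ m (fun p : EuclideanSpace ℝ (Fin n) => 1 + ‖p‖ ^ 2) :=
    contDiff_const.add (contDiff_norm_sq ℝ)
  have hpos : ∀ p : EuclideanSpace ℝ (Fin n), 1 + ‖p‖ ^ 2 ≠ 0 := fun p => by positivity
  have h2 : ContDiff ℝ m (fun p : EuclideanSpace ℝ (Fin n) => Real.sqrt (1 + ‖p‖ ^ 2)) :=
      h1.sqrt hpos
  have hpos' : ∀ p : EuclideanSpace ℝ (Fin n), Real.sqrt (1 + ‖p‖ ^ 2) ≠ 0 := fun p => by positivity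
  unfold mcCoeff
  exact (h2.inv hpos').mul (contDiff_const.sub (((hc i).mul (hc j)).div h1 hpos))

lemma sum_mcCoeff_mul_self_pos (p : EuclideanSpace ℝ (Fin n)) {L : EuclideanSpace ℝ (Fin n) →L[ℝ] ℝ}
    (hL : L ≠ 0) :
    0 < ∑ i, ∑ j, mcCoeff p i j * (L (EuclideanSpace.single i 1) *
      L (EuclideanSpace.single j 1)) := by
  have h := sum_mcCoeff_mul p (L.smulRight L)
  simp only [ContinuousLinearMap.smulRight_apply, smul_apply, smul_eq_mul] at h
  rw [h]
  have hLp : ∀ y, L y = ∑ i, y i * L (EuclideanSpace.single i 1) := fun y => by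
    simpa using (sum_apply_single y L).symm
  set S := ∑ i, L (EuclideanSpace.single i 1) * L (EuclideanSpace.single i 1) with hS
  have hcs : L p * L p ≤ ‖p‖ ^ 2 * S := by
    have := Finset.sum_mul_sq_le_sq_mul_sq Finset.univ (fun i => p i)
      (fun i => L (EuclideanSpace.single i 1))
    rw [← hLp, ← EuclideanSpace.real_norm_sq_eq] at this
    simpa [sq, hS] using this
  have hSpos : 0 < S := by
    have hS0 : 0 ≤ S := Finset.sum_nonneg fun i _ => mul_self_nonneg _
    refine lt_of_le_of_ne hS0 fun h0 => hL ?_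
    rw [eq_comm, Finset.sum_eq_zero_iff_of_nonneg fun i _ => mul_self_nonneg _] at h0
    ext y
    rw [hLp y]
    simp only [zero_apply]
    exact Finset.sum_eq_zero fun i hi => by rw [mul_self_eq_zero.1 (h0 i hi), mul_zero]
  refine mul_pos (by positivity) ?_
  rw [sub_pos, div_lt_iff₀ (by positivity)]
  nlinarith

lemma fderiv_exp_comp {φ : EuclideanSpace ℝ (Fin n) → ℝ} (hφ : ContDiff ℝ 2 φ) (a α : ℝ)
    (x : EuclideanSpace ℝ (Fin n)) :
    HasFDerivAt (fun y => a * (Real.exp (α * φ y) - 1))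
      ((a * α * Real.exp (α * φ x)) • fderiv ℝ φ x) x := by
  have h1 : HasFDerivAt φ (fderiv ℝ φ x) x := (hφ.differentiable (by simp) x).hasFDerivAt
  have := (((h1.const_mul α).exp).sub_const 1).const_mul a
  refine this.congr_fderiv ?_
  rw [smul_smul, smul_smul]
  congr 1
  ring

lemma hessEntry_exp_comp {φ : EuclideanSpace ℝ (Fin n) → ℝ} (hφ : ContDiff ℝ 2 φ) (a α : ℝ)
    (x : EuclideanSpace ℝ (Fin n))
    (i j : Fin n) : hessEntry (fun y => a * (Real.exp (α * φ y) - 1)) x i j =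
      a * Real.exp (α * φ x) * (α ^ 2 * (fderiv ℝ φ x (EuclideanSpace.single i 1) *
        fderiv ℝ φ x (EuclideanSpace.single j 1)) + α * hessEntry φ x i j) := by
  rw [hessEntry_eq, hessEntry_eq]
  have h1 : fderiv ℝ (fun y => a * (Real.exp (α * φ y) - 1)) =
      fun x => (a * α * Real.exp (α * φ x)) • fderiv ℝ φ x :=
    funext fun x => (fderiv_exp_comp hφ a α x).fderiv
  have h2 : HasFDerivAt φ (fderiv ℝ φ x) x := (hφ.differentiable (by simp) x).hasFDerivAt
  have h3 : HasFDerivAt (fderiv ℝ φ) (fderiv ℝ (fderiv ℝ φ) x) x :=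
    ((hφ.fderiv_right (m := 1) (by norm_num)).differentiable (by simp) x).hasFDerivAt
  rw [h1, ((((h2.const_mul α).exp).const_mul (a * α)).fun_smul h3).fderiv]
  simp only [ContinuousLinearMap.smulRight_apply, smul_apply, add_apply, smul_eq_mul]
  ring

/-- Exponentials of functions without critical points are strict subsolutions. -/
lemma exists_exp_subsolution {φ : EuclideanSpace ℝ (Fin n) → ℝ} (hφ : ContDiff ℝ 2 φ)
    {D : Set (EuclideanSpace ℝ (Fin n))}
    (hD : IsCompact D) (hDne : D.Nonempty) (hcrit : ∀ x ∈ D, fderiv ℝ φ x ≠ 0) {ρ : ℝ}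
    (hρ : 0 ≤ ρ) :
    ∃ α : ℝ, 0 < α ∧ ∃ κ : ℝ, 0 < κ ∧ ∀ x ∈ D, ∀ p : EuclideanSpace ℝ (Fin n), ‖p‖ ≤ ρ → ∀ a : ℝ,
        0 ≤ a →
      a * κ ≤ ∑ i, ∑ j, mcCoeff p i j *
        hessEntry (fun y => a * (Real.exp (α * φ y) - 1)) x i j := by
  have hc : IsCompact (D ×ˢ closedBall (0 : EuclideanSpace ℝ (Fin n)) ρ) :=
      hD.prod (isCompact_closedBall _ _)
  have hne : (D ×ˢ closedBall (0 : EuclideanSpace ℝ (Fin n)) ρ).Nonempty :=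
    hDne.prod ⟨0, by simpa using hρ⟩
  have hmc : ∀ i j, Continuous fun z : EuclideanSpace ℝ (Fin n) ×
      (EuclideanSpace ℝ (Fin n)) => mcCoeff z.2 i j := fun i j =>
    (contDiff_mcCoeff (m := 0) i j).continuous.comp continuous_snd
  have hd1 : Continuous (fderiv ℝ φ) := hφ.continuous_fderiv (by simp)
  have hd2 : Continuous (fderiv ℝ (fderiv ℝ φ)) :=
    (hφ.fderiv_right (m := 1) (by norm_num)).continuous_fderiv (by simp)
  have hd1' : ∀ i, Continuous fun z : EuclideanSpace ℝ (Fin n) × (EuclideanSpace ℝ (Fin n)) =>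
      fderiv ℝ φ z.1 (EuclideanSpace.single i 1) := fun i =>
    (hd1.clm_apply continuous_const).comp continuous_fst
  have hd2' : ∀ i j, Continuous fun z : EuclideanSpace ℝ (Fin n) ×
      (EuclideanSpace ℝ (Fin n)) => hessEntry φ z.1 i j := fun i j => by
    simp_rw [hessEntry_eq]
    exact ((hd2.clm_apply continuous_const).clm_apply continuous_const).comp continuous_fst
  obtain ⟨z₀, hz₀, hz₀min⟩ := hc.exists_isMinOn hne (f := fun z => ∑ i, ∑ j, mcCoeff z.2 i j *
      (fderiv ℝ φ z.1 (EuclideanSpace.single i 1) * fderiv ℝ φ z.1 (EuclideanSpace.single j 1)))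
    (continuous_finsetSum _ fun i _ => continuous_finsetSum _ fun j _ =>
      (hmc i j).mul ((hd1' i).mul (hd1' j))).continuousOn
  obtain ⟨M, hM⟩ := hc.exists_bound_of_continuousOn
    (f := fun z => ∑ i, ∑ j, mcCoeff z.2 i j * hessEntry φ z.1 i j)
    (continuous_finsetSum _ fun i _ => continuous_finsetSum _ fun j _ =>
      (hmc i j).mul (hd2' i j)).continuousOn
  have hA0 := sum_mcCoeff_mul_self_pos z₀.2 (hcrit z₀.1 hz₀.1)
  set A₀ := ∑ i, ∑ j, mcCoeff z₀.2 i j * (fderiv ℝ φ z₀.1 (EuclideanSpace.single i 1) *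
    fderiv ℝ φ z₀.1 (EuclideanSpace.single j 1)) with hA₀
  have hM0 : 0 ≤ M := (norm_nonneg _).trans (hM z₀ hz₀)
  set α := (M + 1) / A₀ with hα
  have hα0 : 0 < α := by positivity
  obtain ⟨x₁, hx₁, hx₁min⟩ := hD.exists_isMinOn hDne (f := fun x => Real.exp (α * φ x))
    (hφ.continuous.const_mul α).rexp.continuousOn
  refine ⟨α, hα0, Real.exp (α * φ x₁) * α, by positivity, fun x hx p hp a ha => ?_⟩
  have hz : (x, p) ∈ D ×ˢ closedBall (0 : EuclideanSpace ℝ (Fin n)) ρ := ⟨hx, by simpa using hp⟩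
  have e1 : A₀ ≤ _ := hz₀min hz
  have e2 := neg_le_of_abs_le (hM _ hz)
  have e3 : Real.exp (α * φ x₁) ≤ Real.exp (α * φ x) := hx₁min hx
  simp only at e1 e2
  have hsum : ∑ i, ∑ j, mcCoeff p i j *
      hessEntry (fun y => a * (Real.exp (α * φ y) - 1)) x i j =
      a * Real.exp (α * φ x) * (α ^ 2 * (∑ i, ∑ j, mcCoeff p i j *
        (fderiv ℝ φ x (EuclideanSpace.single i 1) * fderiv ℝ φ x (EuclideanSpace.single j 1)))
      + α * ∑ i, ∑ j, mcCoeff p i j * hessEntry φ x i j) := by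
    simp_rw [Finset.mul_sum, ← Finset.sum_add_distrib, Finset.mul_sum, hessEntry_exp_comp hφ]
    exact Finset.sum_congr rfl fun i _ => Finset.sum_congr rfl fun j _ => by ring
  rw [hsum, mul_assoc]
  refine mul_le_mul_of_nonneg_left ?_ ha
  have hαA : α * A₀ = M + 1 := by rw [hα]; field_simp
  refine mul_le_mul e3 ?_ hα0.le (Real.exp_pos _).le
  have e4 := mul_le_mul_of_nonneg_left e1 (sq_nonneg α)
  have e5 := mul_le_mul_of_nonneg_left e2 hα0.le
  have e6 : α ^ 2 * A₀ = α * (M + 1) := by rw [sq, mul_assoc, hαA]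
  linarith

lemma fderiv_comp_add_smul {F G : Type*} [NormedAddCommGroup F] [NormedSpace ℝ F]
    [NormedAddCommGroup G] [NormedSpace ℝ G] (w : F → G) (p : F) (a s : ℝ) :
    fderiv ℝ (fun y => a • w (p + s • y)) = fun y => (a * s) • fderiv ℝ w (p + s • y) := by
  have h1 := fderiv_const_smul_field (𝕜 := ℝ) (f := fun y => w (p + s • y)) a
  funext y
  have h2 : fderiv ℝ (fun y => a • w (p + s • y)) y = a • fderiv ℝ (fun y => w (p + s • y)) y :=
    congrFun h1 y
  rw [h2, fderiv_comp_smul (f := fun z => w (p + z)), fderiv_comp_add_left, smul_smul]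

lemma hessEntry_scaled (w : EuclideanSpace ℝ (Fin n) → ℝ) (p : EuclideanSpace ℝ (Fin n)) (a s : ℝ)
    (y : EuclideanSpace ℝ (Fin n)) (i j : Fin n) :
    hessEntry (fun y => a • w (p + s • y)) y i j = a * s ^ 2 * hessEntry w (p + s • y) i j := by
  rw [hessEntry_eq, hessEntry_eq, fderiv_comp_add_smul, fderiv_comp_add_smul (fderiv ℝ w)]
  simp only [smul_apply, smul_eq_mul]
  ring

/-- A function whose differential vanishes nowhere and whose superlevel set, cut at height one,
is compact and lies in the half space `0 ≤ ⟪x, ν⟫`. -/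
lemma exists_barrier_shape {ν y₀ : EuclideanSpace ℝ (Fin n)} (hν : inner ℝ y₀ ν = 1) {δ : ℝ}
    (hδ : 0 < δ) :
    ∃ φ : EuclideanSpace ℝ (Fin n) → ℝ, ContDiff ℝ 2 φ ∧ (∀ x, fderiv ℝ φ x ≠ 0) ∧
      IsCompact {x | 0 ≤ φ x ∧ inner ℝ x ν ≤ 1} ∧ (∀ x, φ x ≤ inner ℝ x ν) ∧
      (∀ x, 0 ≤ φ x → inner ℝ x ν = 1 → ‖x - y₀‖ ≤ δ) ∧ ∀ t : ℝ, φ (t • y₀) = t := by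
  set K := (δ ^ 2)⁻¹ with hK
  have hK0 : 0 < K := by positivity
  set φ := fun x : EuclideanSpace ℝ (Fin n) => inner ℝ x ν - K *
      ‖x - (inner ℝ x ν : ℝ) • y₀‖ ^ 2 with hφ
  have hi : ContDiff ℝ 2 (fun x : EuclideanSpace ℝ (Fin n) => (inner ℝ x ν : ℝ)) :=
      contDiff_id.inner ℝ contDiff_const
  have hφ2 : ContDiff ℝ 2 φ :=
    hi.sub (contDiff_const.mul ((contDiff_id.sub (hi.smul contDiff_const)).norm_sq ℝ))
  have hle : ∀ x, φ x ≤ inner ℝ x ν := fun x => by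
    have : 0 ≤ K * ‖x - (inner ℝ x ν : ℝ) • y₀‖ ^ 2 := by positivity
    simp only [hφ]; linarith
  have hnear : ∀ x, 0 ≤ φ x → inner ℝ x ν ≤ 1 → ‖x - (inner ℝ x ν : ℝ) • y₀‖ ≤ δ := by
    intro x hx h1
    have h2 : K * ‖x - (inner ℝ x ν : ℝ) • y₀‖ ^ 2 ≤ 1 := by
      simp only [hφ] at hx; linarith
    rw [hK, inv_mul_le_iff₀ (by positivity), mul_one] at h2
    exact le_of_sq_le_sq h2 hδ.le
  refine ⟨φ, hφ2, fun x hx => ?_, ?_, hle, fun x hx h1 => ?_, fun t => ?_⟩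
  · have hline : (fun t : ℝ => φ (x + t • y₀)) = fun t => φ x + t := by
      funext t
      simp only [hφ]
      have h3 : (inner ℝ (x + t • y₀) ν : ℝ) = inner ℝ x ν + t := by
        rw [inner_add_left, inner_smul_left, hν]; simp
      rw [h3]
      have h4 : x + t • y₀ - ((inner ℝ x ν : ℝ) + t) • y₀ = x - (inner ℝ x ν : ℝ) • y₀ := by
        module
      rw [h4]; ring
    have h1 := (eventually_deriv_line (hφ2.contDiffAt (x := x)) y₀).self_of_nhds
    rw [hline] at h1
    have h2 : HasDerivAt (fun t : ℝ => φ x + t) 1 0 := (hasDerivAt_id (0 : ℝ)).const_add _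
    have h3 := h1.unique h2
    rw [zero_smul, add_zero, hx] at h3
    simp at h3
  · refine Metric.isCompact_of_isClosed_isBounded ?_ ?_
    · exact (isClosed_le continuous_const hφ2.continuous).inter
        (isClosed_le hi.continuous continuous_const)
    · refine isBounded_iff_forall_norm_le.2 ⟨δ + ‖y₀‖, fun x hx => ?_⟩
      have h1 := hnear x hx.1 hx.2
      have h2 : 0 ≤ inner ℝ x ν := hx.1.trans (hle x)
      calc ‖x‖ = ‖(x - (inner ℝ x ν : ℝ) • y₀) + (inner ℝ x ν : ℝ) • y₀‖ := by simp
        _ ≤ δ + ‖(inner ℝ x ν : ℝ) • y₀‖ := (norm_add_le _ _).trans (by gcongr)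
        _ ≤ δ + ‖y₀‖ := by
          rw [norm_smul, Real.norm_of_nonneg h2]
          nlinarith [norm_nonneg y₀, hx.2]
  · have := hnear x hx h1.le
    rwa [h1, one_smul] at this
  · simp [hφ, inner_smul_left, hν]

/-- A degenerate zero of an analytic solution of a linear elliptic equation has, in every open half
space of directions, a direction along which the solution is negative. -/
theorem exists_direction_neg {w : EuclideanSpace ℝ (Fin n) → ℝ}
    {P : EuclideanSpace ℝ (Fin n) → EuclideanSpace ℝ (Fin n)} {p : EuclideanSpace ℝ (Fin n)}
    (hw : AnalyticAt ℝ w p) (hP : ContinuousAt P p)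
    (hineq : ∃ C : ℝ, ∀ᶠ y in 𝓝 p, |∑ i, ∑ j, mcCoeff (P y) i j * hessEntry w y i j| ≤
      C * (‖fderiv ℝ w y‖ + |w y|))
    (h0 : w p = 0) (h1 : fderiv ℝ w p = 0) (hne : ¬ ∀ᶠ y in 𝓝 p, w y = 0)
    {ν : EuclideanSpace ℝ (Fin n)} (hν : ν ≠ 0) :
    ∃ y : EuclideanSpace ℝ (Fin n), 0 < inner ℝ y ν ∧ ∀ᶠ s in 𝓝[>] (0 : ℝ), w (p + s • y) < 0 := by
  by_contra! hcon
  obtain ⟨m, hm, H, hHc, hHh, hHne, C, r, hC0, hr, hCr⟩ := hw.exists_leading_term h0 h1 hne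
  have hscale : ∀ s : ℝ, 0 < s → ∀ y : EuclideanSpace ℝ (Fin n), s * ‖y‖ < r →
      |(s ^ m)⁻¹ • w (p + s • y) - H y| ≤ C * s * ‖y‖ ^ (m + 1) := by
    intro s hs y hsy
    have h2 := hCr (s • y) (by rwa [norm_smul, Real.norm_of_nonneg hs.le])
    rw [hHh, norm_smul, Real.norm_of_nonneg hs.le] at h2
    have h3 : (s ^ m)⁻¹ • w (p + s • y) - H y = (s ^ m)⁻¹ * (w (p + s • y) - s ^ m * H y) := by
      rw [smul_eq_mul]; field_simp
    rw [h3, abs_mul, abs_of_pos (by positivity : (0 : ℝ) < (s ^ m)⁻¹),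
      inv_mul_le_iff₀ (by positivity)]
    refine h2.trans (le_of_eq ?_)
    ring
  have hnn : ∀ y, 0 < inner ℝ y ν → 0 ≤ H y := by
    intro y hy
    by_contra! hneg
    refine hcon y hy ?_
    have hlim1 : Filter.Tendsto (fun s : ℝ => s * ‖y‖) (𝓝[>] 0) (𝓝 0) := by
      have : Continuous fun s : ℝ => s * ‖y‖ := by fun_prop
      simpa using (this.tendsto 0).mono_left nhdsWithin_le_nhds
    have hlim2 : Filter.Tendsto (fun s : ℝ => C * s * ‖y‖ ^ (m + 1)) (𝓝[>] 0) (𝓝 0) := by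
      have : Continuous fun s : ℝ => C * s * ‖y‖ ^ (m + 1) := by fun_prop
      simpa using (this.tendsto 0).mono_left nhdsWithin_le_nhds
    filter_upwards [hlim1.eventually_lt_const hr, hlim2.eventually_lt_const (neg_pos.2 hneg),
      self_mem_nhdsWithin] with s hs1 hs2 hs
    have hs0 : 0 < s := hs
    have h3 := (abs_le.1 (hscale s hs0 y hs1)).2
    have h4 : (s ^ m)⁻¹ * w (p + s • y) < 0 := by
      rw [smul_eq_mul] at h3; linarith
    by_contra! h5
    exact absurd h4 (not_lt.2 (by positivity))
  obtain ⟨y₀, hy₀ν, hy₀⟩ := exists_pos_of_homogeneous hHc hHh hHne hν hnn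
  set c₀ := H y₀ / 2 with hc₀
  have hc₀0 : 0 < c₀ := by positivity
  obtain ⟨δ, hδ, hδH⟩ : ∃ δ > 0, ∀ x, ‖x - y₀‖ ≤ δ → c₀ < H x := by
    have h2 : ∀ᶠ x in 𝓝 y₀, c₀ < H x :=
      hHc.continuousAt.eventually_const_lt (by rw [hc₀]; linarith)
    obtain ⟨δ, hδ, h3⟩ := Metric.nhds_basis_closedBall.eventually_iff.1 h2
    exact ⟨δ, hδ, fun x hx => h3 (by rwa [mem_closedBall, dist_eq_norm])⟩
  obtain ⟨φ, hφ2, hφd, hDc, hφle, hφtop, hφline⟩ := exists_barrier_shape hy₀ν hδ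
  set D := {x : EuclideanSpace ℝ (Fin n) | 0 ≤ φ x ∧ inner ℝ x ν ≤ 1} with hD
  have hDne : D.Nonempty := ⟨(0 : ℝ) • y₀, by rw [hφline], by simp⟩
  obtain ⟨α, hα, κ, hκ, hsub⟩ := exists_exp_subsolution hφ2 hDc hDne (fun x _ => hφd x)
    (ρ := ‖P p‖ + 1) (by positivity)
  set ψ := fun x => Real.exp (α * φ x) - 1 with hψ
  have hψ2 : ContDiff ℝ 2 ψ := (contDiff_const.mul hφ2).exp.sub contDiff_const
  obtain ⟨Mψ, hMψ⟩ := hDc.exists_bound_of_continuousOn hψ2.continuous.continuousOn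
  obtain ⟨Md, hMd⟩ := hDc.exists_bound_of_continuousOn
    (hψ2.continuous_fderiv (by simp)).continuousOn
  obtain ⟨MH, hMH⟩ := hDc.exists_bound_of_continuousOn hHc.continuousOn
  obtain ⟨MD, hMD⟩ := hDc.exists_bound_of_continuousOn continuous_id.continuousOn
  simp only [id] at hMD
  obtain ⟨z₀, hz₀⟩ := id hDne
  have hMψ0 : 0 ≤ Mψ := (norm_nonneg _).trans (hMψ z₀ hz₀)
  have hMd0 : 0 ≤ Md := (norm_nonneg _).trans (hMd z₀ hz₀)
  have hMH0 : 0 ≤ MH := (norm_nonneg _).trans (hMH z₀ hz₀)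
  have hMD0 : 0 ≤ MD := (norm_nonneg _).trans (hMD z₀ hz₀)
  set ε := c₀ / (Mψ + 1) with hε
  have hε0 : 0 < ε := by positivity
  have hεψ : ∀ x ∈ D, ε * ψ x ≤ c₀ := fun x hx => by
    have h2 : ψ x ≤ Mψ + 1 := ((le_abs_self _).trans (hMψ x hx)).trans (by linarith)
    calc ε * ψ x ≤ ε * (Mψ + 1) := by gcongr
      _ = c₀ := by rw [hε]; field_simp
  have hDnn : ∀ x ∈ D, 0 ≤ H x := by
    intro x hx
    have h2 : 0 ≤ inner ℝ x ν := hx.1.trans (hφle x)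
    have h3 : Filter.Tendsto (fun t : ℝ => H (x + t • y₀)) (𝓝[>] 0) (𝓝 (H x)) := by
      have : Continuous fun t : ℝ => H (x + t • y₀) := by fun_prop
      simpa using (this.tendsto 0).mono_left nhdsWithin_le_nhds
    refine ge_of_tendsto h3 ?_
    filter_upwards [self_mem_nhdsWithin] with t ht
    have ht0 : 0 < t := ht
    refine hnn _ ?_
    rw [inner_add_left, inner_smul_left, hy₀ν]
    simp only [conj_trivial]
    linarith
  -- the barrier exceeds `H` somewhere
  obtain ⟨x₁, hx₁, hneg⟩ : ∃ x₁ ∈ D, H x₁ - ε * ψ x₁ < 0 := by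
    set t := min 1 (ε * α / (2 * H y₀)) with ht
    have ht0 : 0 < t := lt_min one_pos (by positivity)
    have ht1 : t ≤ 1 := min_le_left _ _
    refine ⟨t • y₀, ⟨?_, ?_⟩, ?_⟩
    · rw [hφline]; exact ht0.le
    · rw [inner_smul_left, hy₀ν]; simpa using ht1
    · rw [hHh]
      simp only [hψ, hφline]
      have h2 : t ^ m ≤ t ^ 2 := pow_le_pow_of_le_one ht0.le ht1 hm
      have h3 : α * t ≤ Real.exp (α * t) - 1 := by
        linarith [Real.add_one_le_exp (α * t)]
      have h4 : t * H y₀ ≤ ε * α / 2 := by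
        calc t * H y₀ ≤ ε * α / (2 * H y₀) * H y₀ := by
              gcongr; exact min_le_right _ _
          _ = ε * α / 2 := by field_simp
      have h5 : t ^ m * H y₀ ≤ t ^ 2 * H y₀ := by gcongr
      have h6 : ε * (α * t) ≤ ε * (Real.exp (α * t) - 1) := by gcongr
      have h7 : t * (t * H y₀) ≤ t * (ε * α / 2) := by gcongr
      have h8 : 0 < t * (ε * α) := by positivity
      nlinarith
  set η := -(H x₁ - ε * ψ x₁) with hη
  have hη0 : 0 < η := by rw [hη]; linarith
  obtain ⟨C₁, hC₁⟩ := hineq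
  -- choose a small scale
  have hPb : ∀ᶠ y in 𝓝 p, ‖P y‖ ≤ ‖P p‖ + 1 :=
    (hP.norm.eventually_lt_const (lt_add_one _)).mono fun y hy => hy.le
  have hwc : ∀ᶠ y in 𝓝 p, ContDiffAt ℝ 2 w y :=
    hw.eventually_analyticAt.mono fun y hy => hy.contDiffAt
  obtain ⟨r₁, hr₁, hall⟩ := Metric.eventually_nhds_iff.1 (hC₁.and (hPb.and hwc))
  obtain ⟨s, hs0, hs1, hsr, hsr₁, hsη, hsκ⟩ : ∃ s : ℝ, 0 < s ∧ s < 1 ∧ s * MD < r ∧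
      s * MD < r₁ ∧ C * s * MD ^ (m + 1) < η / 3 ∧
      s * (|C₁| * (ε * Md + (MH + η))) < ε * κ := by
    have hev : ∀ {g : ℝ → ℝ}, Continuous g → g 0 = 0 → ∀ {b : ℝ}, 0 < b →
        ∀ᶠ s in 𝓝[>] (0 : ℝ), g s < b := fun hg h0 b hb =>
      (hg.tendsto' 0 0 h0).eventually_lt_const hb |>.filter_mono nhdsWithin_le_nhds
    have := (self_mem_nhdsWithin : Ioi (0 : ℝ) ∈ 𝓝[>] (0 : ℝ))
    obtain ⟨s, hs⟩ := ((Filter.Eventually.and this (hev continuous_id rfl one_pos)).and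
      ((hev (g := fun s => s * MD) (by fun_prop) (by simp) hr).and
      ((hev (g := fun s => s * MD) (by fun_prop) (by simp) hr₁).and
      ((hev (g := fun s => C * s * MD ^ (m + 1)) (by fun_prop) (by simp)
        (by positivity : 0 < η / 3)).and
      (hev (g := fun s => s * (|C₁| * (ε * Md + (MH + η)))) (by fun_prop) (by simp)
        (by positivity : 0 < ε * κ)))))).exists
    exact ⟨s, hs.1.1, hs.1.2, hs.2.1, hs.2.2.1, hs.2.2.2.1, hs.2.2.2.2⟩
  set W := fun y => (s ^ m)⁻¹ • w (p + s • y) with hW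
  have hclose : ∀ x ∈ D, |W x - H x| < η / 3 := fun x hx => by
    have h2 : ‖x‖ ≤ MD := hMD x hx
    refine (hscale s hs0 x (lt_of_le_of_lt (by gcongr) hsr)).trans_lt (lt_of_le_of_lt ?_ hsη)
    gcongr
  have hmem : ∀ x ∈ D, dist (p + s • x) p < r₁ := fun x hx => by
    rw [dist_eq_norm, add_sub_cancel_left, norm_smul, Real.norm_of_nonneg hs0.le]
    exact lt_of_le_of_lt (by gcongr; exact hMD x hx) hsr₁
  have hW2 : ∀ x ∈ D, ContDiffAt ℝ 2 W x := fun x hx => by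
    have h2 := (hall (hmem x hx)).2.2
    exact (h2.comp x (by fun_prop : ContDiffAt ℝ 2
        (fun y : EuclideanSpace ℝ (Fin n) => p + s • y) x)).const_smul _
  have hWc : ContinuousOn W D := fun x hx => (hW2 x hx).continuousAt.continuousWithinAt
  obtain ⟨x₂, hx₂, hx₂max⟩ := hDc.exists_isMaxOn (f := fun x => -W x + ε * ψ x) ⟨x₁, hx₁⟩
    (hWc.neg.add (continuousOn_const.mul hψ2.continuous.continuousOn))
  have hval : 2 * η / 3 < -W x₂ + ε * ψ x₂ := by
    have h2 : -W x₁ + ε * ψ x₁ ≤ -W x₂ + ε * ψ x₂ := hx₂max hx₁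
    have h3 := (abs_lt.1 (hclose x₁ hx₁)).2
    linarith
  have hHx₂ := (abs_lt.1 (hclose x₂ hx₂)).1
  have hφx₂ : 0 < φ x₂ := by
    refine lt_of_le_of_ne hx₂.1 fun h => ?_
    have h2 : ψ x₂ = 0 := by simp [hψ, ← h]
    rw [h2] at hval
    linarith [hDnn x₂ hx₂]
  have htop : inner ℝ x₂ ν < 1 := by
    refine lt_of_le_of_ne hx₂.2 fun h => ?_
    have h2 := hδH x₂ (hφtop x₂ hx₂.1 h)
    linarith [hεψ x₂ hx₂]
  have hnhds : D ∈ 𝓝 x₂ := by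
    have h2 : Continuous fun x : EuclideanSpace ℝ (Fin n) => (inner ℝ x ν : ℝ) := by fun_prop
    filter_upwards [hφ2.continuous.continuousAt.eventually_const_lt hφx₂,
      h2.continuousAt.eventually_lt_const htop] with x h3 h4
    exact ⟨h3.le, h4.le⟩
  have hloc : IsLocalMax (fun x => -W x + ε * ψ x) x₂ := hx₂max.isLocalMax hnhds
  have hWx₂ := hW2 x₂ hx₂
  have hεψ2 : ContDiff ℝ 2 fun x => ε * ψ x := contDiff_const.mul hψ2
  obtain ⟨hlin, hPx₂, -⟩ := hall (hmem x₂ hx₂)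
  have htest := IsLocalMax.sum_mcCoeff_mul_hessEntry_add_nonpos hWx₂.neg hεψ2.contDiffAt hloc
    (P (p + s • x₂))
  have hgrad : fderiv ℝ W x₂ = ε • fderiv ℝ ψ x₂ := by
    have h2 := hloc.fderiv_eq_zero
    rw [fderiv_fun_add (hWx₂.neg.differentiableAt (by simp))
      (hεψ2.contDiffAt.differentiableAt (by simp)), fderiv_fun_neg,
      fderiv_const_mul (hψ2.contDiffAt.differentiableAt (by simp))] at h2
    exact (neg_add_eq_zero.1 h2)
  have hgradW : fderiv ℝ W x₂ = ((s ^ m)⁻¹ * s) • fderiv ℝ w (p + s • x₂) :=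
    congrFun (fderiv_comp_add_smul w p _ s) x₂
  have hhess : ∀ i j, hessEntry (fun y => -W y) x₂ i j =
      -((s ^ m)⁻¹ * s ^ 2) * hessEntry w (p + s • x₂) i j := fun i j => by
    have : (fun y => -W y) = fun y => (-(s ^ m)⁻¹) • w (p + s • y) := by
      funext y; simp [hW]
    rw [this, hessEntry_scaled]; ring
  have hlow := hsub x₂ hx₂ (P (p + s • x₂)) hPx₂ ε hε0.le
  have hsumW : ∑ i, ∑ j, mcCoeff (P (p + s • x₂)) i j * hessEntry (fun y => -W y) x₂ i j =
      -((s ^ m)⁻¹ * s ^ 2) * ∑ i, ∑ j, mcCoeff (P (p + s • x₂)) i j *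
        hessEntry w (p + s • x₂) i j := by
    simp_rw [hhess, Finset.mul_sum]
    exact Finset.sum_congr rfl fun i _ => Finset.sum_congr rfl fun j _ => by ring
  rw [hsumW] at htest
  have hA : ε * κ ≤ ((s ^ m)⁻¹ * s ^ 2) * (C₁ * (‖fderiv ℝ w (p + s • x₂)‖ +
      |w (p + s • x₂)|)) := by
    have h2 : ((s ^ m)⁻¹ * s ^ 2) * (∑ i, ∑ j, mcCoeff (P (p + s • x₂)) i j *
        hessEntry w (p + s • x₂) i j) ≤ ((s ^ m)⁻¹ * s ^ 2) * (C₁ *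
        (‖fderiv ℝ w (p + s • x₂)‖ + |w (p + s • x₂)|)) :=
      mul_le_mul_of_nonneg_left ((le_abs_self _).trans hlin) (by positivity)
    linarith
  have hB1 : (s ^ m)⁻¹ * s * ‖fderiv ℝ w (p + s • x₂)‖ ≤ ε * Md := by
    have h2 := congrArg norm hgradW
    rw [hgrad, norm_smul, norm_smul, Real.norm_of_nonneg hε0.le,
      Real.norm_of_nonneg (by positivity)] at h2
    rw [← h2]
    gcongr
    exact hMd x₂ hx₂
  have hB2 : (s ^ m)⁻¹ * |w (p + s • x₂)| ≤ MH + η := by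
    have h2 : (s ^ m)⁻¹ * |w (p + s • x₂)| = |W x₂| := by
      simp only [hW, smul_eq_mul]
      rw [abs_mul, abs_of_pos (by positivity : (0 : ℝ) < (s ^ m)⁻¹)]
    rw [h2]
    have h3 : |W x₂| ≤ |W x₂ - H x₂| + |H x₂| := by
      simpa using abs_add_le (W x₂ - H x₂) (H x₂)
    have h4 : |H x₂| ≤ MH := hMH x₂ hx₂
    linarith [hclose x₂ hx₂]
  have hC₁le : ((s ^ m)⁻¹ * s ^ 2) * (C₁ * (‖fderiv ℝ w (p + s • x₂)‖ + |w (p + s • x₂)|)) ≤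
      s * (|C₁| * (ε * Md + (MH + η))) := by
    calc _ ≤ ((s ^ m)⁻¹ * s ^ 2) * (|C₁| * (‖fderiv ℝ w (p + s • x₂)‖ + |w (p + s • x₂)|)) := by
          gcongr; exact le_abs_self _
      _ = s * (|C₁| * ((s ^ m)⁻¹ * s * ‖fderiv ℝ w (p + s • x₂)‖ +
          s * ((s ^ m)⁻¹ * |w (p + s • x₂)|))) := by ring
      _ ≤ s * (|C₁| * (ε * Md + 1 * (MH + η))) := by gcongr
      _ = _ := by ring
  linarith

lemma meanCurv_eq (u : EuclideanSpace ℝ (Fin n) → ℝ) (x : EuclideanSpace ℝ (Fin n)) :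
    meanCurv u x = (Real.sqrt (1 + ‖gradient u x‖ ^ 2))⁻¹ *
      (∑ i, fderiv ℝ (fderiv ℝ u) x (EuclideanSpace.single i 1) (EuclideanSpace.single i 1) -
        fderiv ℝ (fderiv ℝ u) x (gradient u x) (gradient u x) / (1 + ‖gradient u x‖ ^ 2)) := by
  rw [← sum_mcCoeff_mul, meanCurv]
  simp_rw [hessEntry_eq]

lemma norm_gradient_sub (u v : EuclideanSpace ℝ (Fin n) → ℝ) (x y : EuclideanSpace ℝ (Fin n)) :
    ‖gradient u x - gradient v y‖ = ‖fderiv ℝ u x - fderiv ℝ v y‖ := by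
  rw [gradient, gradient, ← map_sub, LinearIsometryEquiv.norm_map]

lemma continuousAt_gradient {u : EuclideanSpace ℝ (Fin n) → ℝ} {x : EuclideanSpace ℝ (Fin n)}
    (hu : ContDiffAt ℝ 2 u x) :
    ContinuousAt (gradient u) x := by
  have h : ContinuousAt (fderiv ℝ u) x :=
    (hu.fderiv_right (m := 0) (by norm_num)).continuousAt
  exact ((InnerProductSpace.toDual ℝ (EuclideanSpace ℝ (Fin n))).symm.continuous.continuousAt
      (x := fderiv ℝ u x)).comp h

lemma sum_apply_isometry (g : EuclideanSpace ℝ (Fin n) ≃ₗᵢ[ℝ] EuclideanSpace ℝ (Fin n))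
    (Q : EuclideanSpace ℝ (Fin n) →L[ℝ] EuclideanSpace ℝ (Fin n) →L[ℝ] ℝ) :
    ∑ i, Q (g (EuclideanSpace.single i 1)) (g (EuclideanSpace.single i 1)) =
      ∑ i, Q (EuclideanSpace.single i 1) (EuclideanSpace.single i 1) := by
  set T : EuclideanSpace ℝ (Fin n) →ₗ[ℝ] EuclideanSpace ℝ (Fin n) :=
    (InnerProductSpace.toDual ℝ (EuclideanSpace ℝ (Fin n))).symm.toLinearEquiv.toLinearMap ∘ₗ
    Q.toLinearMap with hT
  have hTQ : ∀ x y, inner ℝ y (T x) = Q x y := fun x y => by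
    rw [real_inner_comm]
    exact InnerProductSpace.toDual_symm_apply
  have h1 := T.trace_eq_sum_inner (EuclideanSpace.basisFun (Fin n) ℝ)
  have h2 := T.trace_eq_sum_inner ((EuclideanSpace.basisFun (Fin n) ℝ).map g)
  simp only [hTQ, EuclideanSpace.basisFun_apply, OrthonormalBasis.map_apply] at h1 h2
  rw [← h2, h1]

lemma gradient_comp_isometry (u : EuclideanSpace ℝ (Fin n) → ℝ)
    (g : EuclideanSpace ℝ (Fin n) ≃ₗᵢ[ℝ] EuclideanSpace ℝ (Fin n)) (x : EuclideanSpace ℝ (Fin n)) :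
    g (gradient (u ∘ g) x) = gradient u (g x) := by
  refine ext_inner_right ℝ fun y => ?_
  have h := (g.toContinuousLinearEquiv).comp_right_fderiv (f := u) (x := x)
  have h2 : inner ℝ (g (gradient (u ∘ g) x)) y = inner ℝ (gradient (u ∘ g) x) (g.symm y) := by
    rw [← g.inner_map_map (gradient (u ∘ g) x) (g.symm y), g.apply_symm_apply]
  rw [h2, inner_gradient_left, inner_gradient_left]
  have h3 := congrArg (fun T => T (g.symm y)) h
  simpa using h3

lemma fderiv_fderiv_comp_isometry (u : EuclideanSpace ℝ (Fin n) → ℝ)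
    (g : EuclideanSpace ℝ (Fin n) ≃ₗᵢ[ℝ] EuclideanSpace ℝ (Fin n)) {x : EuclideanSpace ℝ (Fin n)}
    (hu : ContDiffAt ℝ 2 u (g x)) (a b : EuclideanSpace ℝ (Fin n)) :
    fderiv ℝ (fderiv ℝ (u ∘ g)) x a b = fderiv ℝ (fderiv ℝ u) (g x) (g a) (g b) := by
  have h1 : fderiv ℝ (u ∘ g) =
      fun y => (fderiv ℝ u (g y)).comp (g.toContinuousLinearEquiv :
          EuclideanSpace ℝ (Fin n) →L[ℝ] EuclideanSpace ℝ (Fin n)) :=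
    funext fun y => (g.toContinuousLinearEquiv).comp_right_fderiv (f := u) (x := y)
  have h2 : HasFDerivAt (fderiv ℝ u) (fderiv ℝ (fderiv ℝ u) (g x)) (g x) :=
    ((hu.fderiv_right (m := 1) (by norm_num)).differentiableAt (by simp)).hasFDerivAt
  have h3 := h2.comp x (g.toContinuousLinearEquiv :
      EuclideanSpace ℝ (Fin n) →L[ℝ] EuclideanSpace ℝ (Fin n)).hasFDerivAt
  have h4 := h3.clm_comp (hasFDerivAt_const
      (g.toContinuousLinearEquiv : EuclideanSpace ℝ (Fin n) →L[ℝ] EuclideanSpace ℝ (Fin n)) x)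
  rw [h1]
  erw [h4.fderiv]
  simp

lemma meanCurv_comp_isometry (u : EuclideanSpace ℝ (Fin n) → ℝ)
    (g : EuclideanSpace ℝ (Fin n) ≃ₗᵢ[ℝ] EuclideanSpace ℝ (Fin n)) {x : EuclideanSpace ℝ (Fin n)}
    (hu : ContDiffAt ℝ 2 u (g x)) : meanCurv (u ∘ g) x = meanCurv u (g x) := by
  rw [meanCurv_eq, meanCurv_eq]
  have hn : ‖gradient (u ∘ g) x‖ = ‖gradient u (g x)‖ := by
    rw [← gradient_comp_isometry, g.norm_map]
  simp_rw [fderiv_fderiv_comp_isometry u g hu, gradient_comp_isometry, hn]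
  rw [sum_apply_isometry g]

lemma exists_lipschitz_mcCoeff (ρ : ℝ) : ∃ L : ℝ,
    0 ≤ L ∧ ∀ (i j : Fin n) (p q : EuclideanSpace ℝ (Fin n)),
    ‖p‖ ≤ ρ → ‖q‖ ≤ ρ → |mcCoeff p i j - mcCoeff q i j| ≤ L * ‖p - q‖ := by
  have h1 : ∀ ij : Fin n × Fin n, ∃ K : NNReal,
      LipschitzOnWith K (fun p : EuclideanSpace ℝ (Fin n) => mcCoeff p ij.1 ij.2)
          (closedBall 0 ρ) := fun ij =>
    (contDiff_mcCoeff (m := 1) ij.1 ij.2).contDiffOn.exists_lipschitzOnWith (by simp)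
      (convex_closedBall _ _) (isCompact_closedBall _ _)
  choose K hK using h1
  refine ⟨∑ ij, (K ij : ℝ), Finset.sum_nonneg fun _ _ => NNReal.coe_nonneg _,
    fun i j p q hp hq => ?_⟩
  have h2 := (hK (i, j)).dist_le_mul p (by simpa using hp) q (by simpa using hq)
  rw [Real.dist_eq, dist_eq_norm] at h2
  refine h2.trans ?_
  gcongr
  exact Finset.single_le_sum (f := fun ij => (K ij : ℝ)) (fun _ _ => NNReal.coe_nonneg _)
    (Finset.mem_univ _)

lemma continuousAt_hessEntry {u : EuclideanSpace ℝ (Fin n) → ℝ} {x : EuclideanSpace ℝ (Fin n)}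
    (hu : ContDiffAt ℝ 2 u x) (i j : Fin n) :
    ContinuousAt (fun y => hessEntry u y i j) x := by
  simp_rw [hessEntry_eq]
  have h : ContinuousAt (fderiv ℝ (fderiv ℝ u)) x :=
    ((hu.fderiv_right (m := 1) (by norm_num)).fderiv_right (m := 0) (by norm_num)).continuousAt
  exact (h.clm_apply continuousAt_const).clm_apply continuousAt_const

lemma hessEntry_sub {u v : EuclideanSpace ℝ (Fin n) → ℝ} {x : EuclideanSpace ℝ (Fin n)}
    (hu : ContDiffAt ℝ 2 u x)
    (hv : ContDiffAt ℝ 2 v x) (i j : Fin n) :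
    hessEntry (fun y => v y - u y) x i j = hessEntry v x i j - hessEntry u x i j := by
  simp_rw [hessEntry_eq]
  have h1 : fderiv ℝ (fun x => v x - u x) =ᶠ[𝓝 x] fun y => fderiv ℝ v y - fderiv ℝ u y := by
    filter_upwards [hv.eventually (by simp), hu.eventually (by simp)] with y h1 h2
    exact fderiv_fun_sub (h1.differentiableAt (by simp)) (h2.differentiableAt (by simp))
  have hd : ∀ {g : EuclideanSpace ℝ (Fin n) → ℝ}, ContDiffAt ℝ 2 g x →
      DifferentiableAt ℝ (fderiv ℝ g) x :=
    fun hg => (hg.fderiv_right (m := 1) (by norm_num)).differentiableAt (by simp)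
  rw [h1.fderiv_eq, fderiv_fun_sub (hd hv) (hd hu)]
  simp

/-- Comparison principle for the mean curvature equation. -/
theorem meanCurv_comparison (i₀ : Fin n) {Ω : Set (EuclideanSpace ℝ (Fin n))} (hΩ : IsOpen Ω)
    (hb : Bornology.IsBounded Ω) {f : ℝ → ℝ} (hf : Monotone f) {u v : EuclideanSpace ℝ (Fin n) → ℝ}
    (hu : ∀ x ∈ Ω, ContDiffAt ℝ 2 u x) (hv : ∀ x ∈ Ω, ContDiffAt ℝ 2 v x)
    (huc : ContinuousOn u (closure Ω)) (hvc : ContinuousOn v (closure Ω))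
    (hue : ∀ x ∈ Ω, meanCurv u x = f (u x)) (hve : ∀ x ∈ Ω, meanCurv v x = f (v x))
    (hbd : ∀ x ∈ frontier Ω, v x ≤ u x) : ∀ x ∈ Ω, v x ≤ u x := by
  have h := weak_maximum_principle i₀ hΩ hb (w := fun x => v x - u x) (P := gradient v)
    (hvc.sub huc) (fun x hx => (hv x hx).sub (hu x hx)) (fun x hx => sub_nonpos.2 (hbd x hx))
    (fun x hx => (continuousAt_gradient (hv x hx)).continuousWithinAt) ?_
  · exact fun x hx => sub_nonpos.1 (h x hx)
  intro x hx
  set ρ := ‖gradient u x‖ + ‖gradient v x‖ + 1 with hρ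
  obtain ⟨L, hL0, hL⟩ := exists_lipschitz_mcCoeff (n := n) ρ
  set M := ∑ i, ∑ j, (|hessEntry u x i j| + 1) with hM
  refine ⟨L * M, ?_⟩
  have e1 : ∀ᶠ y in 𝓝 x, ‖gradient u y‖ < ρ :=
    (continuousAt_gradient (hu x hx)).norm.eventually_lt_const
      (by rw [hρ]; linarith [norm_nonneg (gradient v x)])
  have e2 : ∀ᶠ y in 𝓝 x, ‖gradient v y‖ < ρ :=
    (continuousAt_gradient (hv x hx)).norm.eventually_lt_const
      (by rw [hρ]; linarith [norm_nonneg (gradient u x)])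
  have e3 : ∀ᶠ y in 𝓝 x, ∀ i j, |hessEntry u y i j| < |hessEntry u x i j| + 1 := by
    rw [Filter.eventually_all]; intro i
    rw [Filter.eventually_all]; intro j
    exact (continuousAt_hessEntry (hu x hx) i j).abs.eventually_lt_const (lt_add_one _)
  filter_upwards [e1, e2, e3, hΩ.mem_nhds hx] with y h1 h2 h3 hy hpos
  have hfle : f (u y) ≤ f (v y) := hf (sub_pos.1 hpos).le
  rw [← hue y hy, ← hve y hy, meanCurv, meanCurv] at hfle
  have hgrad : ‖gradient v y - gradient u y‖ = ‖fderiv ℝ (fun x => v x - u x) y‖ := by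
    rw [norm_gradient_sub, fderiv_fun_sub ((hv y hy).differentiableAt (by simp))
      ((hu y hy).differentiableAt (by simp))]
  have hdiff : |∑ i, ∑ j, (mcCoeff (gradient v y) i j - mcCoeff (gradient u y) i j) *
      hessEntry u y i j| ≤ L * M * ‖fderiv ℝ (fun x => v x - u x) y‖ := by
    calc _ ≤ ∑ i, ∑ j, |(mcCoeff (gradient v y) i j - mcCoeff (gradient u y) i j) *
          hessEntry u y i j| := (Finset.abs_sum_le_sum_abs _ _).trans
            (Finset.sum_le_sum fun i _ => Finset.abs_sum_le_sum_abs _ _)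
      _ ≤ ∑ i, ∑ j, (L * ‖fderiv ℝ (fun x => v x - u x) y‖) * (|hessEntry u x i j| + 1) := by
          refine Finset.sum_le_sum fun i _ => Finset.sum_le_sum fun j _ => ?_
          rw [abs_mul, ← hgrad]
          exact mul_le_mul (hL i j _ _ h2.le h1.le) (h3 i j).le (abs_nonneg _) (by positivity)
      _ = _ := by
          simp_rw [hM, Finset.mul_sum, Finset.sum_mul]
          exact Finset.sum_congr rfl fun i _ => Finset.sum_congr rfl fun j _ => by ring
  have hsplit : ∑ i, ∑ j, mcCoeff (gradient v y) i j * hessEntry (fun x => v x - u x) y i j =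
      (∑ i, ∑ j, mcCoeff (gradient v y) i j * hessEntry v y i j -
        ∑ i, ∑ j, mcCoeff (gradient u y) i j * hessEntry u y i j) -
      ∑ i, ∑ j, (mcCoeff (gradient v y) i j - mcCoeff (gradient u y) i j) *
        hessEntry u y i j := by
    simp_rw [← Finset.sum_sub_distrib, hessEntry_sub (hu y hy) (hv y hy)]
    exact Finset.sum_congr rfl fun i _ => Finset.sum_congr rfl fun j _ => by ring
  rw [hsplit]
  have := (abs_le.1 hdiff).2
  linarith

/-- The equation satisfied by a directional derivative of a solution. -/
theorem linearized_equation {Ω : Set (EuclideanSpace ℝ (Fin n))} (hΩ : IsOpen Ω) {f : ℝ → ℝ}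
    (hf : Differentiable ℝ f)
    {u : EuclideanSpace ℝ (Fin n) → ℝ} (hu : ∀ x ∈ Ω, ContDiffAt ℝ 3 u x)
    (hue : ∀ x ∈ Ω, meanCurv u x = f (u x)) (d : EuclideanSpace ℝ (Fin n))
    {x : EuclideanSpace ℝ (Fin n)} (hx : x ∈ Ω) :
    ∑ i, ∑ j, (mcCoeff (gradient u x) i j * hessEntry (fun y => fderiv ℝ u y d) x i j +
      fderiv ℝ (fun p => mcCoeff p i j) (gradient u x)
        ((InnerProductSpace.toDual ℝ (EuclideanSpace ℝ (Fin n))).symm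
            (fderiv ℝ (fun y => fderiv ℝ u y d) x)) *
        hessEntry u x i j) = deriv f (u x) * fderiv ℝ u x d := by
  have hu2 : ∀ y ∈ Ω, ContDiffAt ℝ 2 (fderiv ℝ u) y := fun y hy =>
    (hu y hy).fderiv_right (by norm_num)
  have hu1 : ∀ y ∈ Ω, HasFDerivAt (fderiv ℝ u) (fderiv ℝ (fderiv ℝ u) y) y := fun y hy =>
    ((hu2 y hy).differentiableAt (by simp)).hasFDerivAt
  have hT : HasFDerivAt (fderiv ℝ (fderiv ℝ u)) (fderiv ℝ (fderiv ℝ (fderiv ℝ u)) x) x :=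
    (((hu2 x hx).fderiv_right (m := 1) (by norm_num)).differentiableAt (by simp)).hasFDerivAt
  have hsym1 : ∀ y ∈ Ω, ∀ a b, fderiv ℝ (fderiv ℝ u) y a b = fderiv ℝ (fderiv ℝ u) y b a :=
    fun y hy a b => ((hu y hy).isSymmSndFDerivAt (by simp; norm_num)) a b
  have hsym2 : ∀ a b, fderiv ℝ (fderiv ℝ (fderiv ℝ u)) x a b =
      fderiv ℝ (fderiv ℝ (fderiv ℝ u)) x b a :=
    fun a b => ((hu2 x hx).isSymmSndFDerivAt (by simp)) a b
  have hw1 : ∀ y ∈ Ω, fderiv ℝ (fun y => fderiv ℝ u y d) y = fderiv ℝ (fderiv ℝ u) y d := by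
    intro y hy
    rw [((hu1 y hy).clm_apply (hasFDerivAt_const d y)).fderiv]
    ext a
    simp [hsym1 y hy a d]
  have hwh : ∀ i j, hessEntry (fun y => fderiv ℝ u y d) x i j =
      fderiv ℝ (fderiv ℝ (fderiv ℝ u)) x d (EuclideanSpace.single i 1)
        (EuclideanSpace.single j 1) := by
    intro i j
    rw [hessEntry_eq]
    have h1 : fderiv ℝ (fun y => fderiv ℝ u y d) =ᶠ[𝓝 x] fun y => fderiv ℝ (fderiv ℝ u) y d := by
      filter_upwards [hΩ.mem_nhds hx] with y hy using hw1 y hy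
    rw [h1.fderiv_eq, (hT.clm_apply (hasFDerivAt_const d x)).fderiv]
    simp [hsym2 d]
  have hG : HasFDerivAt (gradient u)
      (((InnerProductSpace.toDual ℝ (EuclideanSpace ℝ (Fin n))).symm :
      (EuclideanSpace ℝ (Fin n) →L[ℝ] ℝ) ≃ₗᵢ[ℝ] EuclideanSpace ℝ
          (Fin n)).toContinuousLinearEquiv.toContinuousLinearMap.comp
        (fderiv ℝ (fderiv ℝ u) x)) x :=
    ((InnerProductSpace.toDual ℝ (EuclideanSpace ℝ (Fin n))).symm :
      (EuclideanSpace ℝ (Fin n) →L[ℝ] ℝ) ≃ₗᵢ[ℝ] EuclideanSpace ℝ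
          (Fin n)).toContinuousLinearEquiv.toContinuousLinearMap.hasFDerivAt.comp
        x (hu1 x hx)
  have hH : ∀ i j, HasFDerivAt (fun y => hessEntry u y i j)
      (((fderiv ℝ (fderiv ℝ (fderiv ℝ u)) x).flip (EuclideanSpace.single i 1)).flip
        (EuclideanSpace.single j 1)) x := by
    intro i j
    simp_rw [hessEntry_eq]
    refine ((hT.clm_apply (hasFDerivAt_const (EuclideanSpace.single i 1) x)).clm_apply
      (hasFDerivAt_const (EuclideanSpace.single j 1) x)).congr_fderiv ?_
    ext a
    simp
  have hmc : ∀ i j, HasFDerivAt (fun p : EuclideanSpace ℝ (Fin n) => mcCoeff p i j)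
      (fderiv ℝ (fun p => mcCoeff p i j) (gradient u x)) (gradient u x) := fun i j =>
    ((contDiff_mcCoeff (m := 1) i j).differentiable (by simp) _).hasFDerivAt
  have hL := HasFDerivAt.fun_sum (u := Finset.univ) fun i _ => HasFDerivAt.fun_sum
    (u := Finset.univ) fun j _ => ((hmc i j).comp x hG).mul (hH i j)
  have hR : HasFDerivAt (fun y => f (u y)) (deriv f (u x) • fderiv ℝ u x) x :=
    (hf (u x)).hasDerivAt.comp_hasFDerivAt x
      ((hu x hx).differentiableAt (by simp)).hasFDerivAt
  have heq : (fun y => f (u y)) =ᶠ[𝓝 x] fun y => ∑ i, ∑ j,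
      ((fun p : EuclideanSpace ℝ (Fin n) => mcCoeff p i j) ∘ gradient u) y * hessEntry u y i j := by
    filter_upwards [hΩ.mem_nhds hx] with y hy
    exact (hue y hy).symm
  have hfin := congrArg (fun T => T d) ((hL.congr_of_eventuallyEq heq).unique hR)
  simp only [sum_apply, add_apply, smul_apply, smul_eq_mul, ContinuousLinearMap.flip_apply,
    ContinuousLinearMap.comp_apply] at hfin
  rw [← hfin]
  refine Finset.sum_congr rfl fun i _ => Finset.sum_congr rfl fun j _ => ?_
  rw [hwh, hw1 x hx]
  simp
  ring

lemma linearized_equation_bound {Ω : Set (EuclideanSpace ℝ (Fin n))} (hΩ : IsOpen Ω) {f : ℝ → ℝ}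
    (hf : Differentiable ℝ f) {u : EuclideanSpace ℝ (Fin n) → ℝ} (hu : ∀ x ∈ Ω, ContDiffAt ℝ 3 u x)
    (hue : ∀ x ∈ Ω, meanCurv u x = f (u x)) (d : EuclideanSpace ℝ (Fin n))
    {x : EuclideanSpace ℝ (Fin n)} (hx : x ∈ Ω) :
    ∃ C : ℝ, 0 ≤ C ∧ ∀ᶠ y in 𝓝 x, |∑ i, ∑ j, mcCoeff (gradient u y) i j *
      hessEntry (fun y => fderiv ℝ u y d) y i j - deriv f (u y) * fderiv ℝ u y d| ≤
      C * ‖fderiv ℝ (fun y => fderiv ℝ u y d) y‖ := by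
  have hu2 : ContDiffAt ℝ 2 u x := (hu x hx).of_le (by norm_num)
  have hD : ∀ i j, ContinuousAt (fun y => fderiv ℝ
      (fun p : EuclideanSpace ℝ (Fin n) => mcCoeff p i j) (gradient u y))
      x := fun i j =>
    (((contDiff_mcCoeff (m := 1) i j).continuous_fderiv (by simp)).continuousAt).comp
      (continuousAt_gradient hu2)
  set M := ∑ i : Fin n, ∑ j : Fin n,
      ((‖fderiv ℝ (fun p : EuclideanSpace ℝ (Fin n) => mcCoeff p i j) (gradient u x)‖ + 1)
    * (|hessEntry u x i j| + 1)) with hM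
  refine ⟨M, by positivity, ?_⟩
  have e1 : ∀ᶠ y in 𝓝 x, ∀ i j, ‖fderiv ℝ (fun p : EuclideanSpace ℝ (Fin n) => mcCoeff p i j)
      (gradient u y)‖ <
      ‖fderiv ℝ (fun p : EuclideanSpace ℝ (Fin n) => mcCoeff p i j) (gradient u x)‖ + 1 := by
    rw [Filter.eventually_all]; intro i
    rw [Filter.eventually_all]; intro j
    exact (hD i j).norm.eventually_lt_const (lt_add_one _)
  have e3 : ∀ᶠ y in 𝓝 x, ∀ i j, |hessEntry u y i j| < |hessEntry u x i j| + 1 := by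
    rw [Filter.eventually_all]; intro i
    rw [Filter.eventually_all]; intro j
    exact (continuousAt_hessEntry hu2 i j).abs.eventually_lt_const (lt_add_one _)
  filter_upwards [e1, e3, hΩ.mem_nhds hx] with y h1 h3 hy
  set N := ‖fderiv ℝ (fun y => fderiv ℝ u y d) y‖ with hN
  have hlin := linearized_equation hΩ hf hu hue d hy
  have hsplit : ∑ i, ∑ j, mcCoeff (gradient u y) i j * hessEntry (fun y => fderiv ℝ u y d) y i j -
      deriv f (u y) * fderiv ℝ u y d = -∑ i, ∑ j,
      fderiv ℝ (fun p => mcCoeff p i j) (gradient u y)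
        ((InnerProductSpace.toDual ℝ (EuclideanSpace ℝ (Fin n))).symm
            (fderiv ℝ (fun y => fderiv ℝ u y d) y)) *
        hessEntry u y i j := by
    rw [← hlin]
    simp_rw [Finset.sum_add_distrib]
    ring
  rw [hsplit, abs_neg]
  calc _ ≤ ∑ i, ∑ j, |fderiv ℝ (fun p => mcCoeff p i j) (gradient u y)
        ((InnerProductSpace.toDual ℝ (EuclideanSpace ℝ (Fin n))).symm
            (fderiv ℝ (fun y => fderiv ℝ u y d) y)) *
        hessEntry u y i j| := (Finset.abs_sum_le_sum_abs _ _).trans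
            (Finset.sum_le_sum fun i _ => Finset.abs_sum_le_sum_abs _ _)
    _ ≤ ∑ i : Fin n, ∑ j : Fin n,
        ((‖fderiv ℝ (fun p : EuclideanSpace ℝ (Fin n) => mcCoeff p i j) (gradient u x)‖ + 1)
        * N) * (|hessEntry u x i j| + 1) := by
        refine Finset.sum_le_sum fun i _ => Finset.sum_le_sum fun j _ => ?_
        rw [abs_mul]
        refine mul_le_mul ?_ (h3 i j).le (abs_nonneg _) (by positivity)
        have h4 := (fderiv ℝ (fun p : EuclideanSpace ℝ (Fin n) => mcCoeff p i j)
            (gradient u y)).le_opNorm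
          ((InnerProductSpace.toDual ℝ (EuclideanSpace ℝ (Fin n))).symm
              (fderiv ℝ (fun y => fderiv ℝ u y d) y))
        rw [LinearIsometryEquiv.norm_map, ← hN] at h4
        exact h4.trans (mul_le_mul_of_nonneg_right (h1 i j).le (norm_nonneg _))
    _ = M * N := by
        simp_rw [hM, Finset.sum_mul]
        exact Finset.sum_congr rfl fun i _ => Finset.sum_congr rfl fun j _ => by ring

/-- Positive analytic solutions of the mean curvature equation in strictly convex smooth axially
symmetric domains. -/
structure IsAxialSolution (k : Fin n) (Ω : Set (EuclideanSpace ℝ (Fin n))) (f : ℝ → ℝ)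
    (u : EuclideanSpace ℝ (Fin n) → ℝ) : Prop where
  nonempty : Ω.Nonempty
  isOpen : IsOpen Ω
  isBounded : Bornology.IsBounded Ω
  strictConvex : StrictConvex ℝ (closure Ω)
  smooth : HasSmoothBoundary Ω
  image_eq : ∀ g : EuclideanSpace ℝ (Fin n) ≃ₗᵢ[ℝ] EuclideanSpace ℝ (Fin n), IsAxisRotation k g →
      g '' Ω = Ω
  analytic_f : AnalyticOnNhd ℝ f Set.univ
  mono : Monotone f
  sol : IsMCSolution Ω f u
  pos : ∀ x ∈ Ω, 0 < u x
  analytic : AnalyticOnNhd ℝ u Ω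
  contDiffOn : ContDiffOn ℝ 1 u (closure Ω)

lemma HasSmoothBoundary.interior_closure {Ω : Set (EuclideanSpace ℝ (Fin n))}
    (hs : HasSmoothBoundary Ω)
    (hΩ : IsOpen Ω) : interior (closure Ω) = Ω := by
  refine subset_antisymm (fun x hx => ?_) (interior_maximal subset_closure hΩ)
  by_contra hxΩ
  have hxf : x ∈ frontier Ω := ⟨interior_subset hx, by rwa [hΩ.interior_eq]⟩
  obtain ⟨V, φ, hV, hxV, hφ, hdφ, hneg, hzero⟩ := hs x hxf
  obtain ⟨v, hv⟩ : ∃ v, 0 < fderiv ℝ φ x v := by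
    obtain ⟨v, hv⟩ : ∃ v, fderiv ℝ φ x v ≠ 0 := by
      by_contra! hall
      exact hdφ x hxV (ContinuousLinearMap.ext hall)
    rcases lt_or_gt_of_ne hv with h | h
    · exact ⟨-v, by simpa using h⟩
    · exact ⟨v, h⟩
  have hφx : φ x = 0 := (hzero x hxV).1 hxf
  have hd : HasDerivAt (fun t : ℝ => φ (x + t • v)) (fderiv ℝ φ x v) 0 := by
    have h1 : HasFDerivAt φ (fderiv ℝ φ x) (x + (0 : ℝ) • v) := by
      simpa using ((hφ.contDiffAt (hV.mem_nhds hxV)).differentiableAt (by simp)).hasFDerivAt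
    have h2 : HasDerivAt (fun t : ℝ => x + t • v) v 0 := by
      simpa using ((hasDerivAt_id (0 : ℝ)).smul_const v).const_add x
    exact h1.comp_hasDerivAt (0 : ℝ) h2
  have hpos : ∀ᶠ t in 𝓝[>] (0 : ℝ), 0 < φ (x + t • v) := by
    have h1 := (hasDerivAt_iff_tendsto_slope.1 hd).eventually_const_lt hv
    have h2 : ∀ᶠ t in 𝓝[>] (0 : ℝ), 0 < slope (fun t : ℝ => φ (x + t • v)) 0 t :=
      h1.filter_mono (nhdsWithin_mono _ fun t (ht : 0 < t) => ne_of_gt ht)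
    filter_upwards [h2, self_mem_nhdsWithin] with t ht ht0
    have ht0' : 0 < t := ht0
    rw [slope_def_field] at ht
    simp only [zero_smul, add_zero, hφx, sub_zero] at ht
    exact (div_pos_iff_of_pos_right ht0').1 ht
  have hmem : ∀ᶠ t in 𝓝[>] (0 : ℝ), x + t • v ∈ V ∩ interior (closure Ω) := by
    have hc : Continuous fun t : ℝ => x + t • v := by fun_prop
    refine (hc.continuousAt.eventually_mem ?_).filter_mono nhdsWithin_le_nhds
    exact (hV.inter isOpen_interior).mem_nhds (by simpa using ⟨hxV, hx⟩)
  obtain ⟨t, ht, htV, htc⟩ := (hpos.and hmem).exists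
  have h1 : x + t • v ∉ Ω := fun h => absurd ((hneg _ htV).1 h) (not_lt.2 ht.le)
  have h2 : x + t • v ∈ frontier Ω := ⟨interior_subset htc, by rwa [hΩ.interior_eq]⟩
  exact ht.ne' ((hzero _ htV).1 h2)

namespace IsAxialSolution

variable {k : Fin n} {Ω : Set (EuclideanSpace ℝ (Fin n))} {f : ℝ → ℝ}
    {u : EuclideanSpace ℝ (Fin n) → ℝ}

lemma interior_closure (h : IsAxialSolution k Ω f u) : interior (closure Ω) = Ω :=
  h.smooth.interior_closure h.isOpen

lemma convex_closure (h : IsAxialSolution k Ω f u) : Convex ℝ (closure Ω) := h.strictConvex.convex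

lemma convex (h : IsAxialSolution k Ω f u) : Convex ℝ Ω :=
  h.interior_closure ▸ h.convex_closure.interior

lemma frontier_eq (h : IsAxialSolution k Ω f u) {x : EuclideanSpace ℝ (Fin n)} (hx : x ∈ closure Ω)
    (hx' : x ∉ Ω) :
    x ∈ frontier Ω := ⟨hx, by rwa [h.isOpen.interior_eq]⟩

lemma isCompact_closure (h : IsAxialSolution k Ω f u) : IsCompact (closure Ω) :=
  h.isBounded.isCompact_closure

lemma contDiffAt (h : IsAxialSolution k Ω f u) {x : EuclideanSpace ℝ (Fin n)} (hx : x ∈ Ω)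
    {m : WithTop ℕ∞} :
    ContDiffAt ℝ m u x := (h.analytic x hx).contDiffAt

lemma nonneg (h : IsAxialSolution k Ω f u) {x : EuclideanSpace ℝ (Fin n)} (hx : x ∈ closure Ω) :
    0 ≤ u x := by
  by_cases hxΩ : x ∈ Ω
  · exact (h.pos x hxΩ).le
  · exact (h.sol.2.2.2 x (h.frontier_eq hx hxΩ)).ge

lemma map_mem (h : IsAxialSolution k Ω f u)
    {g : EuclideanSpace ℝ (Fin n) ≃ₗᵢ[ℝ] EuclideanSpace ℝ (Fin n)} (hg : IsAxisRotation k g)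
    {x : EuclideanSpace ℝ (Fin n)} (hx : x ∈ Ω) : g x ∈ Ω := h.image_eq g hg ▸ mem_image_of_mem g hx

lemma map_mem_iff (h : IsAxialSolution k Ω f u)
    {g : EuclideanSpace ℝ (Fin n) ≃ₗᵢ[ℝ] EuclideanSpace ℝ (Fin n)} (hg : IsAxisRotation k g)
    {x : EuclideanSpace ℝ (Fin n)} : g x ∈ Ω ↔ x ∈ Ω := by
  refine ⟨fun hx => ?_, h.map_mem hg⟩
  rw [← h.image_eq g hg] at hx
  obtain ⟨y, hy, hyx⟩ := hx
  exact g.injective hyx ▸ hy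

lemma map_mem_closure_iff (h : IsAxialSolution k Ω f u)
    {g : EuclideanSpace ℝ (Fin n) ≃ₗᵢ[ℝ] EuclideanSpace ℝ (Fin n)}
    (hg : IsAxisRotation k g) {x : EuclideanSpace ℝ (Fin n)} : g x ∈ closure Ω ↔ x ∈ closure Ω := by
  have h1 : g.toHomeomorph '' closure Ω = closure Ω := by
    rw [g.toHomeomorph.image_closure]
    exact congrArg closure (h.image_eq g hg)
  constructor
  · intro hx
    rw [← h1] at hx
    obtain ⟨y, hy, hyx⟩ := hx
    exact g.injective hyx ▸ hy
  · intro hx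
    rw [← h1]
    exact mem_image_of_mem g.toHomeomorph hx

lemma apply_map_le (h : IsAxialSolution k Ω f u)
    {g : EuclideanSpace ℝ (Fin n) ≃ₗᵢ[ℝ] EuclideanSpace ℝ (Fin n)} (hg : IsAxisRotation k g)
    {x : EuclideanSpace ℝ (Fin n)} (hx : x ∈ Ω) : u (g x) ≤ u x ∧ u x ≤ u (g x) := by
  have hu2 : ∀ y ∈ Ω, ContDiffAt ℝ 2 u y := fun y hy => h.contDiffAt hy
  have hg2 : ∀ y ∈ Ω, ContDiffAt ℝ 2 (u ∘ g) y := fun y hy =>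
    (hu2 _ (h.map_mem hg hy)).comp y g.contDiff.contDiffAt
  have hgc : ContinuousOn (u ∘ g) (closure Ω) :=
    h.sol.2.1.comp g.continuous.continuousOn fun y hy => (h.map_mem_closure_iff hg).2 hy
  have hge : ∀ y ∈ Ω, meanCurv (u ∘ g) y = f ((u ∘ g) y) := fun y hy => by
    rw [meanCurv_comp_isometry u g (hu2 _ (h.map_mem hg hy))]
    exact h.sol.2.2.1 _ (h.map_mem hg hy)
  have hbd : ∀ y ∈ frontier Ω, u (g y) = u y := fun y hy => by
    have h1 : g y ∈ frontier Ω := h.frontier_eq ((h.map_mem_closure_iff hg).2 hy.1) fun h2 =>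
      hy.2 (by rw [h.isOpen.interior_eq]; exact (h.map_mem_iff hg).1 h2)
    rw [h.sol.2.2.2 _ h1, h.sol.2.2.2 _ hy]
  exact ⟨meanCurv_comparison k h.isOpen h.isBounded h.mono hu2 hg2 h.sol.2.1 hgc h.sol.2.2.1 hge
      (fun y hy => (hbd y hy).le) x hx,
    meanCurv_comparison k h.isOpen h.isBounded h.mono hg2 hu2 hgc h.sol.2.1 hge h.sol.2.2.1
      (fun y hy => (hbd y hy).ge) x hx⟩

/-- A solution has the symmetries of its domain. -/
lemma apply_map (h : IsAxialSolution k Ω f u)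
    {g : EuclideanSpace ℝ (Fin n) ≃ₗᵢ[ℝ] EuclideanSpace ℝ (Fin n)} (hg : IsAxisRotation k g)
    {x : EuclideanSpace ℝ (Fin n)} (hx : x ∈ closure Ω) : u (g x) = u x := by
  have hgc : ContinuousOn (u ∘ g) (closure Ω) :=
    h.sol.2.1.comp g.continuous.continuousOn fun y hy => (h.map_mem_closure_iff hg).2 hy
  exact (show EqOn (u ∘ g) u Ω from fun y hy => le_antisymm (h.apply_map_le hg hy).1
    (h.apply_map_le hg hy).2).of_subset_closure hgc h.sol.2.1 subset_closure subset_rfl hx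

lemma uniqueDiffOn (h : IsAxialSolution k Ω f u) : UniqueDiffOn ℝ (closure Ω) :=
  uniqueDiffOn_convex h.convex_closure (h.interior_closure.symm ▸ h.nonempty)

lemma continuousOn_fderivWithin (h : IsAxialSolution k Ω f u) (d : EuclideanSpace ℝ (Fin n)) :
    ContinuousOn (fun x => fderivWithin ℝ u (closure Ω) x d) (closure Ω) :=
  (h.contDiffOn.continuousOn_fderivWithin h.uniqueDiffOn le_rfl).clm_apply continuousOn_const

lemma closure_mem_nhds (h : IsAxialSolution k Ω f u) {x : EuclideanSpace ℝ (Fin n)} (hx : x ∈ Ω) :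
    closure Ω ∈ 𝓝 x := Filter.mem_of_superset (h.isOpen.mem_nhds hx) subset_closure

lemma fderivWithin_eq (h : IsAxialSolution k Ω f u) {x : EuclideanSpace ℝ (Fin n)} (hx : x ∈ Ω) :
    fderivWithin ℝ u (closure Ω) x = fderiv ℝ u x :=
  fderivWithin_of_mem_nhds (h.closure_mem_nhds hx)

lemma deriv_nonneg (h : IsAxialSolution k Ω f u) (t : ℝ) : 0 ≤ deriv f t := h.mono.deriv_nonneg

lemma differentiable_f (h : IsAxialSolution k Ω f u) : Differentiable ℝ f := fun t =>
  (h.analytic_f t (mem_univ t)).differentiableAt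

lemma analyticAt_fderiv_apply (h : IsAxialSolution k Ω f u) (d : EuclideanSpace ℝ (Fin n))
    {x : EuclideanSpace ℝ (Fin n)} (hx : x ∈ Ω) :
    AnalyticAt ℝ (fun y => fderiv ℝ u y d) x :=
  ((ContinuousLinearMap.apply ℝ ℝ d).analyticAt (fderiv ℝ u x)).comp (h.analytic x hx).fderiv

/-- Maximum principle for directional derivatives of a solution. -/
lemma fderiv_apply_nonpos (h : IsAxialSolution k Ω f u) (d : EuclideanSpace ℝ (Fin n))
    {U : Set (EuclideanSpace ℝ (Fin n))} (hU : IsOpen U)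
    (hUΩ : U ⊆ Ω) (hbd : ∀ x ∈ frontier U, fderivWithin ℝ u (closure Ω) x d ≤ 0) :
    ∀ x ∈ U, fderiv ℝ u x d ≤ 0 := by
  have heq : ∀ x ∈ U, (fun x => fderivWithin ℝ u (closure Ω) x d) =ᶠ[𝓝 x]
      fun x => fderiv ℝ u x d := fun x hx => by
    filter_upwards [h.isOpen.mem_nhds (hUΩ hx)] with y hy
    rw [h.fderivWithin_eq hy]
  have hmp := weak_maximum_principle k hU (h.isBounded.subset hUΩ) (P := gradient u)
    ((h.continuousOn_fderivWithin d).mono (closure_mono hUΩ))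
    (fun x hx => ((h.analyticAt_fderiv_apply d (hUΩ hx)).contDiffAt).congr_of_eventuallyEq
      (heq x hx)) hbd
    (fun x hx => (continuousAt_gradient (h.contDiffAt (hUΩ hx))).continuousWithinAt) ?_
  · intro x hx
    rw [← h.fderivWithin_eq (hUΩ hx)]
    exact hmp x hx
  · intro x hx
    obtain ⟨C, -, hC⟩ := linearized_equation_bound h.isOpen h.differentiable_f
      (fun x hx => h.contDiffAt hx) h.sol.2.2.1 d (hUΩ hx)
    refine ⟨C, ?_⟩
    filter_upwards [hC, hU.mem_nhds hx] with y hy hyU hpos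
    simp_rw [hessEntry_eq, (heq y hyU).fderiv.fderiv_eq, (heq y hyU).fderiv_eq]
    simp_rw [hessEntry_eq] at hy
    rw [h.fderivWithin_eq (hUΩ hyU)] at hpos
    have h1 := (abs_le.1 hy).1
    have h2 := mul_nonneg (h.deriv_nonneg (u y)) hpos.le
    linarith

end IsAxialSolution

lemma reflection_orthogonal_singleton_apply (d x : EuclideanSpace ℝ (Fin n)) :
    (ℝ ∙ d)ᗮ.reflection x = x - (2 * (inner ℝ d x / ‖d‖ ^ 2)) • d := by
  rw [Submodule.reflection_orthogonal_apply, Submodule.reflection_singleton_apply]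
  simp only [RCLike.ofReal_real_eq_id, id_eq, neg_sub, mul_smul, two_smul]

lemma isAxisRotation_reflection {k : Fin n} {d : EuclideanSpace ℝ (Fin n)} (hd : d k = 0) :
    IsAxisRotation k (ℝ ∙ d)ᗮ.reflection := by
  constructor
  · rw [reflection_orthogonal_singleton_apply]
    simp [EuclideanSpace.inner_single_right, hd]
  · intro x hx
    rw [reflection_orthogonal_singleton_apply]
    simp [hd, hx]

namespace IsAxialSolution

variable {k : Fin n} {Ω : Set (EuclideanSpace ℝ (Fin n))} {f : ℝ → ℝ}
    {u : EuclideanSpace ℝ (Fin n) → ℝ}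

lemma fderivWithin_nonpos_of_mem (h : IsAxialSolution k Ω f u) {b d : EuclideanSpace ℝ (Fin n)}
    (hb : b ∈ frontier Ω)
    {τ : ℝ} (hτ : 0 < τ) (hbd : b - τ • d ∈ closure Ω) :
    fderivWithin ℝ u (closure Ω) b d ≤ 0 := by
  have hmem : ∀ t ∈ Icc 0 τ, b + t • (-d) ∈ closure Ω := by
    intro t ht
    have h1 := h.convex_closure.add_smul_sub_mem hb.1 hbd (t := t / τ)
      ⟨div_nonneg ht.1 hτ.le, div_le_one_of_le₀ ht.2 hτ.le⟩
    have h2 : b + (t / τ) • (b - τ • d - b) = b + t • (-d) := by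
      rw [sub_sub_cancel_left, smul_neg, smul_smul, div_mul_cancel₀ _ hτ.ne', smul_neg]
    rwa [h2] at h1
  have hL : HasFDerivWithinAt u (fderivWithin ℝ u (closure Ω) b) (closure Ω)
      (b + (0 : ℝ) • (-d)) := by
    rw [zero_smul, add_zero]
    exact (h.contDiffOn.differentiableOn (by simp) b hb.1).hasFDerivWithinAt
  have hl : HasDerivWithinAt (fun t : ℝ => b + t • (-d)) (-d) (Icc 0 τ) 0 := by
    simpa using (((hasDerivAt_id (0 : ℝ)).smul_const (-d)).const_add b).hasDerivWithinAt
  have hd := hL.comp_hasDerivWithinAt (0 : ℝ) hl hmem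
  rw [map_neg] at hd
  have h0 : u b = 0 := h.sol.2.2.2 b hb
  have hmin : IsLocalMinOn (u ∘ fun t : ℝ => b + t • (-d)) (Icc 0 τ) 0 := by
    filter_upwards [self_mem_nhdsWithin] with t ht
    simpa [h0] using h.nonneg (hmem t ht)
  have := hmin.hasFDerivWithinAt_nonneg hd.hasFDerivWithinAt (y := τ)
    (mem_posTangentConeAt_of_segment_subset (by
      rw [segment_eq_Icc (by linarith)]; simp))
  simp at this
  nlinarith

lemma fderivWithin_map (h : IsAxialSolution k Ω f u)
    {g : EuclideanSpace ℝ (Fin n) ≃ₗᵢ[ℝ] EuclideanSpace ℝ (Fin n)}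
    (hg : IsAxisRotation k g) {x : EuclideanSpace ℝ (Fin n)} (hx : x ∈ closure Ω)
    (v : EuclideanSpace ℝ (Fin n)) :
    fderivWithin ℝ u (closure Ω) (g x) (g v) = fderivWithin ℝ u (closure Ω) x v := by
  have hL : HasFDerivWithinAt u (fderivWithin ℝ u (closure Ω) x) (closure Ω) x :=
    (h.contDiffOn.differentiableOn (by simp) x hx).hasFDerivWithinAt
  have hL' : HasFDerivWithinAt u (fderivWithin ℝ u (closure Ω) (g x)) (closure Ω) (g x) :=
    (h.contDiffOn.differentiableOn (by simp) _ ((h.map_mem_closure_iff hg).2 hx)).hasFDerivWithinAt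
  have h1 : HasFDerivWithinAt (u ∘ g) ((fderivWithin ℝ u (closure Ω) (g x)).comp
      (g.toContinuousLinearEquiv : EuclideanSpace ℝ (Fin n) →L[ℝ] EuclideanSpace ℝ (Fin n)))
          (closure Ω) x :=
    hL'.comp x (g.toContinuousLinearEquiv.hasFDerivWithinAt)
      fun y hy => (h.map_mem_closure_iff hg).2 hy
  have h2 := h1.congr (f₁ := u) (fun y hy => (h.apply_map hg hy).symm) (h.apply_map hg hx).symm
  exact (DFunLike.congr_fun ((h.uniqueDiffOn x hx).eq hL h2) v).symm

lemma fderivWithin_map_of_fixed (h : IsAxialSolution k Ω f u)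
    {g : EuclideanSpace ℝ (Fin n) ≃ₗᵢ[ℝ] EuclideanSpace ℝ (Fin n)}
    (hg : IsAxisRotation k g) {x : EuclideanSpace ℝ (Fin n)} (hx : x ∈ closure Ω) (hgx : g x = x)
    (v : EuclideanSpace ℝ (Fin n)) :
    fderivWithin ℝ u (closure Ω) x (g v) = fderivWithin ℝ u (closure Ω) x v := by
  have h1 := h.fderivWithin_map hg hx v
  rwa [hgx] at h1

lemma fderiv_nonpos_of_inner_pos (h : IsAxialSolution k Ω f u) {d : EuclideanSpace ℝ (Fin n)}
    (hdk : d k = 0)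
    {x : EuclideanSpace ℝ (Fin n)} (hx : x ∈ Ω) (hxd : 0 < inner ℝ d x) : fderiv ℝ u x d ≤ 0 := by
  have hd0 : d ≠ 0 := by rintro rfl; simp at hxd
  have hopen : IsOpen {y : EuclideanSpace ℝ (Fin n) | 0 < inner ℝ d y} :=
      isOpen_lt (by fun_prop) (by fun_prop)
  refine h.fderiv_apply_nonpos d (U := Ω ∩ {y | 0 < inner ℝ d y}) (h.isOpen.inter hopen)
    inter_subset_left ?_ x ⟨hx, hxd⟩
  intro b hb
  have hg := isAxisRotation_reflection hdk
  have hbc : b ∈ closure Ω := closure_mono inter_subset_left hb.1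
  have hb0 : 0 ≤ inner ℝ d b := by
    have hcl : IsClosed {y : EuclideanSpace ℝ (Fin n) | 0 ≤ inner ℝ d y} :=
        isClosed_le (by fun_prop) (by fun_prop)
    have hsub : Ω ∩ {y | 0 < inner ℝ d y} ⊆ {y : EuclideanSpace ℝ (Fin n) | 0 ≤ inner ℝ d y} := by
      rintro y ⟨-, hy⟩
      rw [mem_ofPred_eq] at hy ⊢
      exact hy.le
    exact closure_minimal hsub hcl hb.1
  rcases hb0.eq_or_lt with hz | hpos
  · have h1 := h.fderivWithin_map_of_fixed hg hbc
      (by rw [reflection_orthogonal_singleton_apply, ← hz]; simp) d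
    rw [Submodule.reflection_orthogonalComplement_singleton_eq_neg, map_neg] at h1
    linarith
  · have hbΩ : b ∉ Ω := fun hbΩ =>
      hb.2 (by rw [(h.isOpen.inter hopen).interior_eq]; exact ⟨hbΩ, hpos⟩)
    refine h.fderivWithin_nonpos_of_mem (h.frontier_eq hbc hbΩ)
      (τ := 2 * (inner ℝ d b / ‖d‖ ^ 2)) (by positivity) ?_
    rw [← reflection_orthogonal_singleton_apply]
    exact (h.map_mem_closure_iff hg).2 hbc

lemma not_eventually_fderiv_eq_zero (h : IsAxialSolution k Ω f u) {p d : EuclideanSpace ℝ (Fin n)}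
    (hp : p ∈ Ω)
    (hd : d ≠ 0) : ¬ ∀ᶠ y in 𝓝 p, fderiv ℝ u y d = 0 := by
  intro hcon
  have han : AnalyticOnNhd ℝ (fun y => fderiv ℝ u y d) Ω := fun x hx =>
    h.analyticAt_fderiv_apply d hx
  have hzero := han.eqOn_zero_of_preconnected_of_eventuallyEq_zero h.convex.isPreconnected hp hcon
  have hline : Continuous fun t : ℝ => p + t • d := by fun_prop
  have hcpt : IsCompact {t : ℝ | 0 ≤ t ∧ p + t • d ∈ closure Ω} := by
    obtain ⟨R, hR⟩ := h.isBounded.closure.exists_norm_le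
    refine IsCompact.of_isClosed_subset (isCompact_Icc (a := (0 : ℝ)) (b := (R + ‖p‖) / ‖d‖))
      ((isClosed_le continuous_const continuous_id).inter (isClosed_closure.preimage hline)) ?_
    rintro t ⟨ht0, ht⟩
    refine ⟨ht0, (le_div_iff₀ (norm_pos_iff.2 hd)).2 ?_⟩
    have h1 : ‖t • d‖ ≤ ‖p + t • d‖ + ‖p‖ := by
      simpa using norm_sub_le (p + t • d) p
    rw [norm_smul, Real.norm_of_nonneg ht0] at h1
    linarith [hR _ ht]
  obtain ⟨T, ⟨hT0, hTc⟩, hTmax⟩ := hcpt.exists_isGreatest ⟨0, le_rfl, by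
    simpa using subset_closure hp⟩
  have hTΩ : p + T • d ∉ Ω := by
    intro hmem
    have h1 : ∀ᶠ t in 𝓝[>] T, p + t • d ∈ Ω :=
      (hline.continuousAt.eventually_mem (h.isOpen.mem_nhds hmem)).filter_mono nhdsWithin_le_nhds
    obtain ⟨t, ht, htT⟩ := (h1.and self_mem_nhdsWithin).exists
    have htT' : T < t := htT
    exact absurd (hTmax ⟨hT0.trans htT'.le, subset_closure ht⟩) (not_le.2 htT')
  have hT0' : 0 < T := hT0.lt_of_ne (by rintro rfl; simp [hp] at hTΩ)
  have hIco : ∀ t ∈ Ico 0 T, p + t • d ∈ Ω := by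
    intro t ht
    have h1 := h.convex_closure.add_smul_sub_mem_interior (t := 1 - t / T) hTc
      (h.interior_closure.symm ▸ hp)
      ⟨sub_pos.2 ((div_lt_one hT0').2 ht.2), sub_le_self _ (div_nonneg ht.1 hT0)⟩
    rw [h.interior_closure] at h1
    convert h1 using 1
    have h2 : t = T - (1 - t / T) * T := by field_simp; ring
    nth_rewrite 1 [h2]
    module
  have hcont : ContinuousOn (fun t : ℝ => u (p + t • d)) (Icc 0 T) := by
    refine h.sol.2.1.comp hline.continuousOn fun t ht => ?_
    rcases ht.2.eq_or_lt with rfl | hlt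
    · exact hTc
    · exact subset_closure (hIco t ⟨ht.1, hlt⟩)
  have hconst := constant_of_has_deriv_right_zero hcont (fun t ht => by
    have h1 : HasFDerivAt u (fderiv ℝ u (p + t • d)) (p + t • d) :=
      ((h.analytic _ (hIco t ht)).differentiableAt).hasFDerivAt
    have h2 : HasDerivAt (fun t : ℝ => p + t • d) d t := by
      simpa using ((hasDerivAt_id t).smul_const d).const_add p
    have h3 := h1.comp_hasDerivAt t h2
    rw [show fderiv ℝ u (p + t • d) d = 0 from hzero (hIco t ht)] at h3
    exact h3.hasDerivWithinAt) T ⟨hT0, le_rfl⟩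
  simp only [zero_smul, add_zero] at hconst
  rw [h.sol.2.2.2 _ (h.frontier_eq hTc hTΩ)] at hconst
  exact (h.pos p hp).ne hconst

lemma exists_direction_fderiv_neg (h : IsAxialSolution k Ω f u) {p d : EuclideanSpace ℝ (Fin n)}
    (hp : p ∈ Ω)
    (hd : d ≠ 0) (h0 : fderiv ℝ u p d = 0) (h1 : fderiv ℝ (fun y => fderiv ℝ u y d) p = 0)
    {ν : EuclideanSpace ℝ (Fin n)} (hν : ν ≠ 0) : ∃ y : EuclideanSpace ℝ (Fin n), 0 < inner ℝ y ν ∧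
      ∀ᶠ s in 𝓝[>] (0 : ℝ), fderiv ℝ u (p + s • y) d < 0 := by
  refine exists_direction_neg (h.analyticAt_fderiv_apply d hp)
    (continuousAt_gradient (h.contDiffAt hp)) ?_ h0 h1 (h.not_eventually_fderiv_eq_zero hp hd) hν
  obtain ⟨C, hC0, hC⟩ := linearized_equation_bound h.isOpen h.differentiable_f
    (fun x hx => h.contDiffAt hx) h.sol.2.2.1 d hp
  have hfc : ContinuousAt (fun y => deriv f (u y)) p :=
    ContinuousAt.comp ((h.analytic_f (u p) (mem_univ _)).deriv.continuousAt)
      (h.analytic p hp).continuousAt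
  set M := |deriv f (u p)| + 1
  have hM : 0 ≤ M := by positivity
  refine ⟨C + M, ?_⟩
  filter_upwards [hC, hfc.abs.eventually_lt_const (lt_add_one _)] with y hy hfy
  have h3 := abs_sub_abs_le_abs_sub (∑ i, ∑ j, mcCoeff (gradient u y) i j *
      hessEntry (fun y => fderiv ℝ u y d) y i j) (deriv f (u y) * fderiv ℝ u y d)
  rw [abs_mul] at h3
  have h4 := mul_le_mul_of_nonneg_right hfy.le (abs_nonneg (fderiv ℝ u y d))
  have h5 := mul_nonneg hC0 (abs_nonneg (fderiv ℝ u y d))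
  have h6 := mul_nonneg hM (norm_nonneg (fderiv ℝ (fun y => fderiv ℝ u y d) y))
  change |deriv f (u y)| * |fderiv ℝ u y d| ≤ M * _ at h4
  linarith

lemma exists_direction_fderiv_pos (h : IsAxialSolution k Ω f u) {p d : EuclideanSpace ℝ (Fin n)}
    (hp : p ∈ Ω)
    (hd : d ≠ 0) (h0 : fderiv ℝ u p d = 0) (h1 : fderiv ℝ (fun y => fderiv ℝ u y d) p = 0)
    {ν : EuclideanSpace ℝ (Fin n)} (hν : ν ≠ 0) : ∃ y : EuclideanSpace ℝ (Fin n), 0 < inner ℝ y ν ∧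
      ∀ᶠ s in 𝓝[>] (0 : ℝ), 0 < fderiv ℝ u (p + s • y) d := by
  obtain ⟨y, hy, hs⟩ := h.exists_direction_fderiv_neg hp (neg_ne_zero.2 hd)
    (by simpa using h0) (by simp_rw [map_neg]; rw [fderiv_fun_neg, h1, neg_zero]) hν
  exact ⟨y, hy, hs.mono fun s hs => by simpa using hs⟩

/-- Critical points lie on the axis. -/
lemma eq_smul_single_of_fderiv_eq_zero (h : IsAxialSolution k Ω f u) {p : EuclideanSpace ℝ (Fin n)}
    (hp : p ∈ Ω)
    (hcrit : fderiv ℝ u p = 0) : p = p k • EuclideanSpace.single k (1 : ℝ) := by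
  by_contra hne
  set d := p - p k • EuclideanSpace.single k (1 : ℝ) with hd
  have hd0 : d ≠ 0 := sub_ne_zero.2 hne
  have hdk : d k = 0 := by simp [hd]
  have hpd : 0 < inner ℝ d p := by
    have h1 : inner ℝ d p = inner ℝ d d := by
      have h2 : p = d + p k • EuclideanSpace.single k (1 : ℝ) := by rw [hd]; abel
      conv_lhs => rw [h2]
      rw [inner_add_right, inner_smul_right]
      simp [EuclideanSpace.inner_single_right, hdk]
    rw [h1]; exact real_inner_self_pos.2 hd0
  have h0 : fderiv ℝ u p d = 0 := by simp [hcrit]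
  have hle : ∀ᶠ y in 𝓝 p, fderiv ℝ u y d ≤ 0 := by
    have hopen : IsOpen {y : EuclideanSpace ℝ (Fin n) | 0 < inner ℝ d y} :=
        isOpen_lt (by fun_prop) (by fun_prop)
    filter_upwards [h.isOpen.mem_nhds hp, hopen.mem_nhds hpd] with y hy hyd
    exact h.fderiv_nonpos_of_inner_pos hdk hy hyd
  have hmax : IsLocalMax (fun y => fderiv ℝ u y d) p := by
    filter_upwards [hle] with y hy
    rwa [h0]
  obtain ⟨y, -, hy⟩ := h.exists_direction_fderiv_pos hp hd0 h0 hmax.fderiv_eq_zero hd0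
  have hc : ContinuousAt (fun s : ℝ => p + s • y) 0 := by fun_prop
  have hle' : ∀ᶠ s in 𝓝[>] (0 : ℝ), fderiv ℝ u (p + s • y) d ≤ 0 :=
    (hc.eventually (by simpa using hle)).filter_mono nhdsWithin_le_nhds
  obtain ⟨s, h1, h2⟩ := (hy.and hle').exists
  exact absurd h1 (not_lt.2 h2)

lemma fderiv_single_eq_zero (h : IsAxialSolution k Ω f u) {p : EuclideanSpace ℝ (Fin n)}
    (hp : p ∈ Ω)
    (hax : p = p k • EuclideanSpace.single k (1 : ℝ)) {i : Fin n} (hi : i ≠ k) :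
    fderiv ℝ u p (EuclideanSpace.single i 1) = 0 := by
  have hik : (EuclideanSpace.single i (1 : ℝ)) k = 0 := by simp [hi.symm]
  have h1 := h.fderivWithin_map_of_fixed (isAxisRotation_reflection hik) (subset_closure hp)
    (by rw [reflection_orthogonal_singleton_apply, hax]
        simp [EuclideanSpace.inner_single_left, hi]) (EuclideanSpace.single i 1)
  rw [Submodule.reflection_orthogonalComplement_singleton_eq_neg, map_neg,
    h.fderivWithin_eq hp] at h1
  linarith

lemma fderiv_fderiv_single_eq_zero (h : IsAxialSolution k Ω f u) {p : EuclideanSpace ℝ (Fin n)}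
    (hp : p ∈ Ω)
    (hax : p = p k • EuclideanSpace.single k (1 : ℝ)) {i j : Fin n} (hij : i ≠ j) :
    fderiv ℝ (fderiv ℝ u) p (EuclideanSpace.single i 1) (EuclideanSpace.single j 1) = 0 := by
  have key : ∀ {i j : Fin n}, i ≠ k → i ≠ j →
      fderiv ℝ (fderiv ℝ u) p (EuclideanSpace.single i 1) (EuclideanSpace.single j 1) = 0 := by
    intro i j hi hij
    have hik : (EuclideanSpace.single i (1 : ℝ)) k = 0 := by simp [hi.symm]
    have hg := isAxisRotation_reflection hik
    have hgp : (ℝ ∙ EuclideanSpace.single i (1 : ℝ))ᗮ.reflection p = p := by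
      rw [reflection_orthogonal_singleton_apply, hax]; simp [EuclideanSpace.inner_single_left, hi]
    have hgj : (ℝ ∙ EuclideanSpace.single i (1 : ℝ))ᗮ.reflection (EuclideanSpace.single j (1 : ℝ))
        = EuclideanSpace.single j (1 : ℝ) := by
      rw [reflection_orthogonal_singleton_apply]; simp [EuclideanSpace.inner_single_left, hij]
    have h1 := fderiv_fderiv_comp_isometry u (ℝ ∙ EuclideanSpace.single i (1 : ℝ))ᗮ.reflection
      (x := p) (by rw [hgp]; exact h.contDiffAt hp) (EuclideanSpace.single i 1)
      (EuclideanSpace.single j 1)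
    have h2 : u ∘ (ℝ ∙ EuclideanSpace.single i (1 : ℝ))ᗮ.reflection =ᶠ[𝓝 p] u := by
      filter_upwards [h.closure_mem_nhds hp] with y hy
      exact h.apply_map hg hy
    rw [h2.fderiv.fderiv_eq, hgp, hgj, Submodule.reflection_orthogonalComplement_singleton_eq_neg,
      map_neg, neg_apply] at h1
    linarith
  by_cases hi : i = k
  · have hs : IsSymmSndFDerivAt ℝ u p :=
      (h.contDiffAt hp (m := 2)).isSymmSndFDerivAt (by simp)
    rw [hs.eq]
    exact key (by rintro rfl; exact hij hi) hij.symm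
  · exact key hi hij

lemma fderiv_fderiv_apply (h : IsAxialSolution k Ω f u) {p : EuclideanSpace ℝ (Fin n)} (hp : p ∈ Ω)
    (d v : EuclideanSpace ℝ (Fin n)) :
    fderiv ℝ (fun y => fderiv ℝ u y d) p v = fderiv ℝ (fderiv ℝ u) p v d := by
  have h1 : HasFDerivAt (fderiv ℝ u) (fderiv ℝ (fderiv ℝ u) p) p :=
    (h.analytic p hp).fderiv.differentiableAt.hasFDerivAt
  have h2 := h1.clm_apply (hasFDerivAt_const d p)
  rw [h2.fderiv]
  simp

lemma fderiv_fderiv_single_eq_zero' (h : IsAxialSolution k Ω f u) {p : EuclideanSpace ℝ (Fin n)}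
    (hp : p ∈ Ω)
    (hax : p = p k • EuclideanSpace.single k (1 : ℝ)) {i : Fin n}
    (hii : fderiv ℝ (fderiv ℝ u) p (EuclideanSpace.single i 1) (EuclideanSpace.single i 1) = 0) :
    fderiv ℝ (fun y => fderiv ℝ u y (EuclideanSpace.single i 1)) p = 0 := by
  ext v
  rw [← sum_apply_single v (fderiv ℝ (fun y => fderiv ℝ u y (EuclideanSpace.single i 1)) p)]
  refine Finset.sum_eq_zero fun j _ => ?_
  rw [h.fderiv_fderiv_apply hp]
  by_cases hj : j = i
  · rw [hj, hii, smul_zero]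
  · rw [h.fderiv_fderiv_single_eq_zero hp hax hj, smul_zero]

lemma fderiv_fderiv_single_ne_zero (h : IsAxialSolution k Ω f u) {p : EuclideanSpace ℝ (Fin n)}
    (hp : p ∈ Ω)
    (hax : p = p k • EuclideanSpace.single k (1 : ℝ)) {i : Fin n} (hi : i ≠ k) :
    fderiv ℝ (fderiv ℝ u) p (EuclideanSpace.single i 1) (EuclideanSpace.single i 1) ≠ 0 := by
  intro hii
  have hne : EuclideanSpace.single i (1 : ℝ) ≠ 0 := by simp
  obtain ⟨y, hyi, hy⟩ := h.exists_direction_fderiv_pos hp hne (h.fderiv_single_eq_zero hp hax hi)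
    (h.fderiv_fderiv_single_eq_zero' hp hax hii) hne
  have hc : Continuous (fun s : ℝ => p + s • y) := by fun_prop
  have hΩ : ∀ᶠ s in 𝓝[>] (0 : ℝ), p + s • y ∈ Ω :=
    (hc.continuousAt.eventually_mem (h.isOpen.mem_nhds (by simpa using hp))).filter_mono
      nhdsWithin_le_nhds
  obtain ⟨s, ⟨h1, h2⟩, h3⟩ := ((hy.and hΩ).and self_mem_nhdsWithin).exists
  have h3' : 0 < s := h3
  refine absurd h1 (not_lt.2 (h.fderiv_nonpos_of_inner_pos (by simp [hi.symm]) h2 ?_))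
  have hpi : p i = 0 := by rw [hax]; simp [hi]
  have hyi' : 0 < y i := by simpa [EuclideanSpace.inner_single_right] using hyi
  simp [EuclideanSpace.inner_single_left, hpi, h3', hyi']

end IsAxialSolution

/-- The points of `closure Ω` where `u` increases in direction `d`, together with the points
reached from `closure Ω` by leaving it in direction `-d`. -/
def increasingRegion (Ω : Set (EuclideanSpace ℝ (Fin n))) (u : EuclideanSpace ℝ (Fin n) → ℝ)
    (d : EuclideanSpace ℝ (Fin n)) : Set (EuclideanSpace ℝ (Fin n)) :=
  {x | (x ∈ closure Ω ∧ 0 < fderivWithin ℝ u (closure Ω) x d) ∨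
    (x ∉ closure Ω ∧ ∃ b ∈ closure Ω, ∃ τ : ℝ, 0 < τ ∧ x = b - τ • d)}

namespace IsAxialSolution

variable {k : Fin n} {Ω : Set (EuclideanSpace ℝ (Fin n))} {f : ℝ → ℝ}
    {u : EuclideanSpace ℝ (Fin n) → ℝ}

lemma isOpen_fderiv_pos (h : IsAxialSolution k Ω f u) (d : EuclideanSpace ℝ (Fin n)) :
    IsOpen {x | x ∈ Ω ∧ 0 < fderiv ℝ u x d} := by
  have hc : ContinuousOn (fun x => fderiv ℝ u x d) Ω := fun x hx =>
    (h.analyticAt_fderiv_apply d hx).continuousAt.continuousWithinAt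
  exact hc.isOpen_inter_preimage h.isOpen isOpen_Ioi

lemma mem_increasingRegion (h : IsAxialSolution k Ω f u) {x d : EuclideanSpace ℝ (Fin n)}
    (hx : x ∈ Ω)
    (hd : 0 < fderiv ℝ u x d) : x ∈ increasingRegion Ω u d :=
  Or.inl ⟨subset_closure hx, by rwa [h.fderivWithin_eq hx]⟩

/-- From a point where `u` increases in direction `d`, one can leave the domain in direction `-d`
without leaving the increasing region. -/
lemma exists_joinedIn (h : IsAxialSolution k Ω f u) {d : EuclideanSpace ℝ (Fin n)} (hd : ‖d‖ = 1)
    {T : ℝ}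
    (hT : ∀ x ∈ closure Ω, |inner ℝ x d| ≤ T) {q : EuclideanSpace ℝ (Fin n)} (hq : q ∈ Ω)
    (hqd : 0 < fderiv ℝ u q d) :
    ∃ y, inner ℝ y d = -T ∧
      JoinedIn (increasingRegion Ω u d ∩ {x | |inner ℝ x d| ≤ T}) q y := by
  set V := {x | x ∈ Ω ∧ 0 < fderiv ℝ u x d} with hV
  have hVo : IsOpen V := h.isOpen_fderiv_pos d
  set C := connectedComponentIn V q with hC
  have hqV : q ∈ V := ⟨hq, hqd⟩
  have hCo : IsOpen C := hVo.connectedComponentIn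
  have hCV : C ⊆ V := connectedComponentIn_subset V q
  have hqC : q ∈ C := mem_connectedComponentIn hqV
  have hCconn : IsConnected C := isConnected_connectedComponentIn_iff.2 hqV
  obtain ⟨b, hbC, hb⟩ : ∃ b ∈ frontier C, 0 < fderivWithin ℝ u (closure Ω) b d := by
    by_contra! hcon
    exact absurd hqd (not_lt.2 (h.fderiv_apply_nonpos d hCo (fun x hx => (hCV hx).1) hcon q hqC))
  have hbc : b ∈ closure Ω := closure_mono (fun x hx => (hCV hx).1) hbC.1
  have hbΩ : b ∉ Ω := by
    intro hbΩ
    have hbV : b ∈ V := ⟨hbΩ, by rwa [← h.fderivWithin_eq hbΩ]⟩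
    have h1 : IsPreconnected (insert b C) :=
      hCconn.isPreconnected.subset_closure (subset_insert b C)
        (insert_subset hbC.1 subset_closure)
    have h2 := h1.subset_connectedComponentIn (mem_insert_of_mem b hqC)
      (insert_subset hbV hCV) (mem_insert b C)
    exact hbC.2 (by rw [hCo.interior_eq]; exact h2)
  have hbf := h.frontier_eq hbc hbΩ
  obtain ⟨ρ, hρ, hball⟩ : ∃ ρ > 0, ∀ x ∈ ball b ρ ∩ closure Ω,
      0 < fderivWithin ℝ u (closure Ω) x d := by
    have h1 := (h.continuousOn_fderivWithin d b hbc).eventually (lt_mem_nhds hb)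
    obtain ⟨ρ, hρ, h2⟩ := Metric.mem_nhdsWithin_iff.1 h1
    exact ⟨ρ, hρ, fun x hx => h2 hx⟩
  obtain ⟨q₁, hq₁b, hq₁⟩ := mem_closure_iff_nhds.1 hbC.1 _ (ball_mem_nhds b hρ)
  have j1 : JoinedIn (increasingRegion Ω u d ∩ {x | |inner ℝ x d| ≤ T}) q q₁ := by
    refine ((hCo.isConnected_iff_isPathConnected.1 hCconn).joinedIn q hqC q₁ hq₁).mono
      fun x hx => ⟨h.mem_increasingRegion (hCV hx).1 (hCV hx).2, hT x (subset_closure (hCV hx).1)⟩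
  have j2 : JoinedIn (increasingRegion Ω u d ∩ {x | |inner ℝ x d| ≤ T}) q₁ b := by
    have hconv : Convex ℝ (ball b ρ ∩ closure Ω) := (convex_ball b ρ).inter h.convex_closure
    refine ((hconv.isPathConnected ⟨b, mem_ball_self hρ, hbc⟩).joinedIn q₁
      ⟨hq₁b, subset_closure (hCV hq₁).1⟩ b ⟨mem_ball_self hρ, hbc⟩).mono fun x hx => ⟨?_, hT x hx.2⟩
    exact Or.inl ⟨hx.2, hball x hx⟩
  have hdd : inner ℝ d d = (1 : ℝ) := by rw [real_inner_self_eq_norm_sq, hd]; norm_num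
  have hbT := abs_le.1 (hT b hbc)
  refine ⟨b - (T + inner ℝ b d) • d, ?_, j1.trans (j2.trans ?_)⟩
  · rw [inner_sub_left, inner_smul_left, hdd]; simp
  · refine JoinedIn.ofLine (f := fun t : ℝ => b - (t * (T + inner ℝ b d)) • d) (by fun_prop)
      (by simp) (by simp) ?_
    rintro _ ⟨t, ht, rfl⟩
    have hτ : 0 ≤ t * (T + inner ℝ b d) := mul_nonneg ht.1 (by linarith)
    have hτ2 : t * (T + inner ℝ b d) ≤ T + inner ℝ b d :=
      mul_le_of_le_one_left (by linarith) ht.2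
    constructor
    · rcases hτ.eq_or_lt with h0 | hpos
      · left
        simpa [← h0] using ⟨hbc, hb⟩
      · exact Or.inr ⟨fun hmem => absurd hb (not_lt.2 (h.fderivWithin_nonpos_of_mem hbf hpos hmem)),
          b, hbc, _, hpos, rfl⟩
    · change |inner ℝ (b - (t * (T + inner ℝ b d)) • d) d| ≤ T
      rw [inner_sub_left, inner_smul_left, hdd, abs_le]
      simp only [RCLike.conj_to_real, mul_one]
      constructor <;> linarith

/-- A curve starting at `p` in a direction of increase and leaving the domain on the other side. -/
lemma exists_curve (h : IsAxialSolution k Ω f u) {d : EuclideanSpace ℝ (Fin n)} (hd : ‖d‖ = 1)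
    {T : ℝ}
    (hT : ∀ x ∈ closure Ω, |inner ℝ x d| ≤ T) {p y : EuclideanSpace ℝ (Fin n)} (hp : p ∈ Ω)
    (hyd : 0 < inner ℝ y d)
    (hy : ∀ᶠ s in 𝓝[>] (0 : ℝ), 0 < fderiv ℝ u (p + s • y) d) :
    ∃ α : ℝ → EuclideanSpace ℝ (Fin n), Continuous α ∧ α 0 = p ∧ inner ℝ (α 1) d = -T ∧
      (∀ s, 0 < s → α s ∈ increasingRegion Ω u d) ∧ (∀ s, 0 ≤ s → |inner ℝ (α s) d| ≤ T) ∧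
      ∀ s, 0 ≤ s → s ≤ 1 / 2 → inner ℝ p d ≤ inner ℝ (α s) d := by
  have hc : Continuous (fun s : ℝ => p + s • y) := by fun_prop
  have hΩ : ∀ᶠ s in 𝓝[>] (0 : ℝ), p + s • y ∈ Ω :=
    (hc.continuousAt.eventually_mem (h.isOpen.mem_nhds (by simpa using hp))).filter_mono
      nhdsWithin_le_nhds
  obtain ⟨ε, hε, hsub⟩ := mem_nhdsGT_iff_exists_Ioc_subset.1 (hy.and hΩ)
  have hε0 : 0 < ε := hε
  have hray : ∀ s, 0 < s → s ≤ ε → 0 < fderiv ℝ u (p + s • y) d ∧ p + s • y ∈ Ω :=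
    fun s h1 h2 => hsub ⟨h1, h2⟩
  set q := p + ε • y with hqdef
  obtain ⟨z, hz, γ, hγ⟩ := h.exists_joinedIn hd hT (hray ε hε0 le_rfl).2 (hray ε hε0 le_rfl).1
  obtain ⟨α, hα⟩ : ∃ α : ℝ → EuclideanSpace ℝ (Fin n), ∀ s, α s =
      p + (ε * (2 * max 0 (min s (1 / 2)))) • y + (γ.extend (2 * s - 1) - q) :=
    ⟨_, fun _ => rfl⟩
  have hlow : ∀ s : ℝ, 0 ≤ s → s ≤ 1 / 2 → α s = p + (ε * (2 * s)) • y := fun s h0 h1 => by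
    rw [hα, γ.extend_of_le_zero (by linarith), sub_self, add_zero, min_eq_left h1, max_eq_right h0]
  have hhigh : ∀ s : ℝ, 1 / 2 ≤ s → α s = γ.extend (2 * s - 1) := fun s h0 => by
    rw [hα, min_eq_right h0, max_eq_right (by norm_num), hqdef]; norm_num
  have hext : ∀ t, γ.extend t ∈ increasingRegion Ω u d ∩ {x | |inner ℝ x d| ≤ T} := fun t => by
    obtain ⟨r, hr⟩ : γ.extend t ∈ range γ := by
      rw [← γ.extend_range]; exact mem_range_self t
    exact hr ▸ hγ r
  have hpT := hT p (subset_closure hp)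
  refine ⟨α, ?_, ?_, ?_, ?_, ?_, ?_⟩
  · rw [funext hα]
    have := γ.continuous_extend
    fun_prop
  · rw [hlow 0 le_rfl (by norm_num)]; simp
  · rw [hhigh 1 (by norm_num), γ.extend_of_one_le (by norm_num), hz]
  · intro s hs
    rcases le_total s (1 / 2) with h1 | h1
    · rw [hlow s hs.le h1]
      have h2 := hray (ε * (2 * s)) (by positivity) (mul_le_of_le_one_right hε0.le (by linarith))
      exact h.mem_increasingRegion h2.2 h2.1
    · rw [hhigh s h1]; exact (hext _).1
  · intro s hs
    rcases le_total s (1 / 2) with h1 | h1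
    · rw [hlow s hs h1]
      rcases hs.eq_or_lt with rfl | hs
      · simpa using hpT
      · exact hT _ (subset_closure (hray (ε * (2 * s)) (by positivity)
          (mul_le_of_le_one_right hε0.le (by linarith))).2)
    · rw [hhigh s h1]; exact (hext _).2
  · intro s h0 h1
    rw [hlow s h0 h1, inner_add_left, inner_smul_left]
    have : 0 ≤ ε * (2 * s) * inner ℝ y d := by positivity
    simpa using this

end IsAxialSolution

lemma eventually_pos_of_hasDerivAt {φ : ℝ → ℝ} {φ' : ℝ} (hφ : HasDerivAt φ φ' 0) (h0 : φ 0 = 0)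
    (hpos : 0 < φ') : ∀ᶠ t in 𝓝[>] (0 : ℝ), 0 < φ t := by
  have h1 := (hasDerivAt_iff_tendsto_slope.1 hφ).eventually_const_lt hpos
  have h2 : ∀ᶠ t in 𝓝[>] (0 : ℝ), 0 < slope φ 0 t :=
    h1.filter_mono (nhdsWithin_mono _ fun t (ht : 0 < t) => ne_of_gt ht)
  filter_upwards [h2, self_mem_nhdsWithin] with t ht ht0
  rw [slope_def_field, h0, sub_zero, sub_zero] at ht
  exact (div_pos_iff_of_pos_right ht0).1 ht

lemma exists_isAxisRotation {k : Fin n} {x y : EuclideanSpace ℝ (Fin n)} (hk : x k = y k)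
    (hr : ‖x‖ ^ 2 - x k ^ 2 = ‖y‖ ^ 2 - y k ^ 2) :
    ∃ g : EuclideanSpace ℝ (Fin n) ≃ₗᵢ[ℝ] EuclideanSpace ℝ (Fin n), IsAxisRotation k g ∧ g x =
        y := by
  have hnorm : ‖x‖ = ‖y‖ := by
    rw [hk, sub_left_inj] at hr
    exact (sq_eq_sq₀ (norm_nonneg _) (norm_nonneg _)).1 hr
  exact ⟨_, isAxisRotation_reflection (d := x - y) (by simp [hk]), Submodule.reflection_sub hnorm⟩

namespace IsAxialSolution

variable {k : Fin n} {Ω : Set (EuclideanSpace ℝ (Fin n))} {f : ℝ → ℝ}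
    {u : EuclideanSpace ℝ (Fin n) → ℝ}

lemma map_mem_increasingRegion (h : IsAxialSolution k Ω f u)
    {g : EuclideanSpace ℝ (Fin n) ≃ₗᵢ[ℝ] EuclideanSpace ℝ (Fin n)}
    (hg : IsAxisRotation k g) {x d : EuclideanSpace ℝ (Fin n)} (hd : g d = d)
    (hx : x ∈ increasingRegion Ω u d) :
    g x ∈ increasingRegion Ω u d := by
  rcases hx with ⟨hx, hpos⟩ | ⟨hx, b, hb, τ, hτ, rfl⟩
  · refine Or.inl ⟨(h.map_mem_closure_iff hg).2 hx, ?_⟩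
    rw [← h.fderivWithin_map hg hx d, hd] at hpos
    exact hpos
  · exact Or.inr ⟨fun hmem => hx ((h.map_mem_closure_iff hg).1 hmem), g b,
      (h.map_mem_closure_iff hg).2 hb, τ, hτ, by rw [map_sub, map_smul, hd]⟩

lemma notMem_increasingRegion_neg (h : IsAxialSolution k Ω f u) {x d : EuclideanSpace ℝ (Fin n)}
    (hx : x ∈ increasingRegion Ω u d) : x ∉ increasingRegion Ω u (-d) := by
  rcases hx with ⟨hx, hpos⟩ | ⟨hx, b, hb, τ, hτ, hxb⟩
  · rintro (⟨-, hneg⟩ | ⟨hx', -⟩)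
    · rw [map_neg] at hneg
      linarith
    · exact hx' hx
  · rintro (⟨hx', -⟩ | ⟨-, b', hb', τ', hτ', hxb'⟩)
    · exact hx hx'
    · refine hx ?_
      have hs := h.convex_closure hb hb' (a := τ' / (τ + τ')) (b := τ / (τ + τ')) (by positivity)
        (by positivity) (by field_simp; ring)
      have e1 : b = x + τ • d := by rw [hxb]; abel
      have e2 : b' = x - τ' • d := by rw [hxb', smul_neg]; abel
      have e3 : (τ' / (τ + τ')) • b + (τ / (τ + τ')) • b' = x := by
        rw [e1, e2]
        have h1 : (τ' / (τ + τ')) + τ / (τ + τ') = 1 := by field_simp; ring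
        have h2 : (τ' / (τ + τ')) * τ - τ / (τ + τ') * τ' = 0 := by field_simp; ring
        calc _ = ((τ' / (τ + τ')) + τ / (τ + τ')) • x +
              ((τ' / (τ + τ')) * τ - τ / (τ + τ') * τ') • d := by module
          _ = x := by rw [h1, h2, one_smul, zero_smul, add_zero]
      rwa [e3] at hs

lemma notMem_increasingRegion_of_critical (h : IsAxialSolution k Ω f u)
    {x d : EuclideanSpace ℝ (Fin n)} (hx : x ∈ Ω)
    (h0 : fderiv ℝ u x d = 0) : x ∉ increasingRegion Ω u d := by
  rintro (⟨-, hpos⟩ | ⟨hx', -⟩)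
  · rw [h.fderivWithin_eq hx, h0] at hpos
    exact lt_irrefl _ hpos
  · exact hx' (subset_closure hx)

/-- At a critical point of the axis, the axial derivative cannot be positive in some upward
direction and negative in some downward direction. -/
lemma not_upward_pos_downward_neg (h : IsAxialSolution k Ω f u) {p y y' : EuclideanSpace ℝ (Fin n)}
    (hp : p ∈ Ω)
    (hax : p = p k • EuclideanSpace.single k (1 : ℝ))
    (h0 : fderiv ℝ u p (EuclideanSpace.single k 1) = 0)
    (hy : 0 < inner ℝ y (EuclideanSpace.single k (1 : ℝ)))
    (hyp : ∀ᶠ s in 𝓝[>] (0 : ℝ), 0 < fderiv ℝ u (p + s • y) (EuclideanSpace.single k 1))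
    (hy' : 0 < inner ℝ y' (-EuclideanSpace.single k (1 : ℝ)))
    (hyp' : ∀ᶠ s in 𝓝[>] (0 : ℝ), 0 < fderiv ℝ u (p + s • y') (-EuclideanSpace.single k 1)) :
    False := by
  set e : EuclideanSpace ℝ (Fin n) := EuclideanSpace.single k (1 : ℝ) with he
  have he1 : ‖e‖ = 1 := by simp [he]
  have hek : ∀ x : EuclideanSpace ℝ (Fin n), inner ℝ x e = x k := fun x => by
    simp [he, EuclideanSpace.inner_single_right]
  obtain ⟨T, hT⟩ := h.isBounded.closure.exists_norm_le
  have hT1 : ∀ x ∈ closure Ω, |inner ℝ x e| ≤ T := fun x hx => by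
    have := abs_real_inner_le_norm x e
    rw [he1, mul_one] at this
    exact this.trans (hT x hx)
  have hT2 : ∀ x ∈ closure Ω, |inner ℝ x (-e)| ≤ T := fun x hx => by
    rw [inner_neg_right, abs_neg]; exact hT1 x hx
  obtain ⟨α, hαc, hα0, hα1, hαr, hαT, hαl⟩ := h.exists_curve he1 hT1 hp hy hyp
  obtain ⟨β, hβc, hβ0, hβ1, hβr, hβT, hβl⟩ :=
    h.exists_curve (by rwa [norm_neg]) hT2 hp hy' hyp'
  simp only [inner_neg_right, hek, abs_neg, neg_le_neg_iff, neg_inj] at hα1 hαT hαl hβ1 hβT hβl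
  have hrp : ‖p‖ ^ 2 - p k ^ 2 = 0 := by
    have : ‖p‖ ^ 2 = p k ^ 2 := by
      conv_lhs => rw [hax, norm_smul, he1, mul_one, Real.norm_eq_abs, sq_abs]
    linarith
  have hr0 : ∀ x : EuclideanSpace ℝ (Fin n), 0 ≤ ‖x‖ ^ 2 - x k ^ 2 := fun x => by
    have h1 := PiLp.norm_apply_le x k
    rw [Real.norm_eq_abs] at h1
    rw [sub_nonneg, ← sq_abs (x k)]
    gcongr
  set c : ℝ → ℝ := fun s => max 0 (min s 1) with hc
  have hc0 : ∀ s, 0 ≤ c s := fun s => le_max_left _ _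
  have hcI : ∀ s ∈ Icc (0 : ℝ) 1, c s = s := fun s hs => by
    simp [hc, hs.1, hs.2]
  have hc00 : c 0 = 0 := hcI 0 (by simp)
  have hc11 : c 1 = 1 := hcI 1 (by simp)
  have hcc : Continuous c := by fun_prop
  set F : ℝ × ℝ → ℂ := fun x =>
    ⟨(‖α (c x.1)‖ ^ 2 - (α (c x.1)) k ^ 2) - (‖β (c x.2)‖ ^ 2 - (β (c x.2)) k ^ 2),
      (α (c x.1)) k - (β (c x.2)) k + max 0 (1 / 2 - c x.1 - c x.2)⟩ with hF
  have hFc : Continuous F := by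
    have h1 : Continuous fun x : ℝ × ℝ => α (c x.1) := hαc.comp (hcc.comp continuous_fst)
    have h2 : Continuous fun x : ℝ × ℝ => β (c x.2) := hβc.comp (hcc.comp continuous_snd)
    have h3 : Continuous fun x : ℝ × ℝ => (α (c x.1)) k :=
      (EuclideanSpace.proj (𝕜 := ℝ) k).continuous.comp h1
    have h4 : Continuous fun x : ℝ × ℝ => (β (c x.2)) k :=
      (EuclideanSpace.proj (𝕜 := ℝ) k).continuous.comp h2
    have h5 : Continuous fun x : ℝ × ℝ => c x.1 := hcc.comp continuous_fst
    have h6 : Continuous fun x : ℝ × ℝ => c x.2 := hcc.comp continuous_snd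
    refine Complex.equivRealProdCLM.symm.continuous.comp (g := fun z : ℝ × ℝ => (⟨z.1, z.2⟩ : ℂ))
      (f := fun x : ℝ × ℝ => (_, _)) (Continuous.prodMk ?_ ?_) <;> fun_prop
  obtain ⟨⟨s₀, t₀⟩, hz⟩ := exists_zero_of_boundary_signs hFc
    (fun t ht => by
      have := hr0 (β (c t))
      simp only [hF, hc00, hα0, hrp, zero_sub]
      linarith)
    (fun s hs => by
      have := hr0 (α (c s))
      simp only [hF, hc00, hβ0, hrp, sub_zero]
      exact this)
    (fun t ht => by
      have h1 := (abs_le.1 (hβT (c t) (hc0 t))).1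
      have h2 : max 0 (1 / 2 - 1 - c t) = 0 := max_eq_left (by linarith [hc0 t])
      simp only [hF, hc11, h2, hα1]
      linarith)
    (fun s hs => by
      have h1 := (abs_le.1 (hαT (c s) (hc0 s))).2
      have h2 : max 0 (1 / 2 - c s - 1) = 0 := max_eq_left (by linarith [hc0 s])
      simp only [hF, hc11, h2, hβ1]
      linarith)
    (by simp [hF, hc00, hα0, hβ0])
  have hre := congrArg Complex.re hz
  have him := congrArg Complex.im hz
  simp only [hF, Complex.zero_re, Complex.zero_im] at hre him
  generalize hs : c s₀ = s at hre him
  generalize ht : c t₀ = t at hre him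
  have hs0 : 0 ≤ s := hs ▸ hc0 s₀
  have ht0 : 0 ≤ t := ht ▸ hc0 t₀
  rcases lt_or_ge (s + t) (1 / 2) with hlt | hge
  · rw [max_eq_right (by linarith)] at him
    linarith [hαl s hs0 (by linarith), hβl t ht0 (by linarith)]
  · rw [max_eq_left (by linarith)] at him
    obtain ⟨g, hg, hgx⟩ := exists_isAxisRotation (k := k) (x := α s) (y := β t) (by linarith)
      (by linarith)
    obtain ⟨g', hg', hgx'⟩ := exists_isAxisRotation (k := k) (x := β t) (y := α s) (by linarith)
      (by linarith)
    have hge' : g' (-e) = -e := by rw [map_neg, hg'.1]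
    rcases hs0.eq_or_lt with rfl | hspos
    · rw [hα0] at hgx'
      exact h.notMem_increasingRegion_of_critical hp (by simp [h0])
        (hgx' ▸ h.map_mem_increasingRegion hg' hge' (hβr t (by linarith)))
    · have h1 : β t ∈ increasingRegion Ω u e :=
        hgx ▸ h.map_mem_increasingRegion hg hg.1 (hαr s hspos)
      rcases ht0.eq_or_lt with rfl | htpos
      · rw [hβ0] at h1
        exact h.notMem_increasingRegion_of_critical hp h0 h1
      · exact h.notMem_increasingRegion_neg h1 (hβr t htpos)

lemma eventually_fderiv_pos (h : IsAxialSolution k Ω f u) {p d v : EuclideanSpace ℝ (Fin n)}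
    (hp : p ∈ Ω)
    (h0 : fderiv ℝ u p d = 0) (hv : 0 < fderiv ℝ (fderiv ℝ u) p v d) :
    ∀ᶠ s in 𝓝[>] (0 : ℝ), 0 < fderiv ℝ u (p + s • v) d := by
  refine eventually_pos_of_hasDerivAt (φ' := fderiv ℝ (fderiv ℝ u) p v d) ?_ (by simp [h0]) hv
  have h1 : HasFDerivAt (fun y => fderiv ℝ u y d) (fderiv ℝ (fun y => fderiv ℝ u y d) p)
      (p + (0 : ℝ) • v) := by
    simpa using (h.analyticAt_fderiv_apply d hp).differentiableAt.hasFDerivAt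
  have h2 : HasDerivAt (fun t : ℝ => p + t • v) v 0 := by
    simpa using ((hasDerivAt_id (0 : ℝ)).smul_const v).const_add p
  rw [← h.fderiv_fderiv_apply hp]
  exact h1.comp_hasDerivAt (0 : ℝ) h2

/-- The second axial derivative is negative at critical points. -/
lemma fderiv_fderiv_axis_neg (h : IsAxialSolution k Ω f u) {p : EuclideanSpace ℝ (Fin n)}
    (hp : p ∈ Ω)
    (hax : p = p k • EuclideanSpace.single k (1 : ℝ))
    (h0 : fderiv ℝ u p (EuclideanSpace.single k 1) = 0) :
    fderiv ℝ (fderiv ℝ u) p (EuclideanSpace.single k 1) (EuclideanSpace.single k 1) < 0 := by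
  have hne : EuclideanSpace.single k (1 : ℝ) ≠ 0 := by simp
  have hee : 0 < inner ℝ (EuclideanSpace.single k (1 : ℝ)) (EuclideanSpace.single k (1 : ℝ)) :=
    real_inner_self_pos.2 hne
  by_contra! hcon
  rcases hcon.eq_or_lt with hz | hpos
  · have h1 := h.fderiv_fderiv_single_eq_zero' hp hax hz.symm
    obtain ⟨y, hy, hyp⟩ := h.exists_direction_fderiv_pos hp hne h0 h1 hne
    obtain ⟨y', hy', hyp'⟩ := h.exists_direction_fderiv_neg hp hne h0 h1 (neg_ne_zero.2 hne)
    exact h.not_upward_pos_downward_neg hp hax h0 hy hyp hy'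
      (hyp'.mono fun s hs => by simpa using hs)
  · exact h.not_upward_pos_downward_neg hp hax h0 hee (h.eventually_fderiv_pos hp h0 hpos)
      (y' := -EuclideanSpace.single k (1 : ℝ)) (by simp)
      (h.eventually_fderiv_pos hp (by simp [h0]) (by simpa using hpos))

lemma exists_fderiv_eq_zero (h : IsAxialSolution k Ω f u) : ∃ p ∈ Ω, fderiv ℝ u p = 0 := by
  obtain ⟨q, hq⟩ := h.nonempty
  obtain ⟨p, hp, hmax⟩ := h.isCompact_closure.exists_isMaxOn ⟨q, subset_closure hq⟩ h.sol.2.1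
  have hpΩ : p ∈ Ω := by
    by_contra hpΩ
    have h1 := hmax (subset_closure hq)
    rw [mem_ofPred_eq, h.sol.2.2.2 p (h.frontier_eq hp hpΩ)] at h1
    exact absurd (h.pos q hq) (not_lt.2 h1)
  exact ⟨p, hpΩ, (hmax.isLocalMax (h.closure_mem_nhds hpΩ)).fderiv_eq_zero⟩

lemma not_lt_of_fderiv_eq_zero (h : IsAxialSolution k Ω f u) {p q : EuclideanSpace ℝ (Fin n)}
    (hp : p ∈ Ω) (hq : q ∈ Ω)
    (hp0 : fderiv ℝ u p = 0) (hq0 : fderiv ℝ u q = 0) : ¬ p k < q k := by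
  intro hlt
  set e : EuclideanSpace ℝ (Fin n) := EuclideanSpace.single k (1 : ℝ) with he
  have hpa := h.eq_smul_single_of_fderiv_eq_zero hp hp0
  have hqa := h.eq_smul_single_of_fderiv_eq_zero hq hq0
  rw [← he] at hpa hqa
  set L := q k - p k with hL
  have hL0 : 0 < L := sub_pos.2 hlt
  have hqL : p + L • e = q := by
    rw [hqa]; nth_rewrite 1 [hpa]; rw [hL]; module
  have hmem : ∀ t ∈ Icc 0 L, p + t • e ∈ Ω := fun t ht => by
    have h1 := h.convex.add_smul_sub_mem hp hq (t := t / L)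
      ⟨div_nonneg ht.1 hL0.le, div_le_one_of_le₀ ht.2 hL0.le⟩
    rwa [← hqL, add_sub_cancel_left, smul_smul, div_mul_cancel₀ _ hL0.ne'] at h1
  have hax : ∀ t, p + t • e = (p + t • e) k • e := fun t => by
    have h1 : (p + t • e) k = p k + t := by simp [he]
    rw [h1]; nth_rewrite 1 [hpa]; module
  set φ : ℝ → ℝ := fun t => fderiv ℝ u (p + t • e) e with hφ
  have hφc : ContinuousOn φ (Icc 0 L) := fun t ht => by
    have h1 := (h.analyticAt_fderiv_apply e (hmem t ht)).continuousAt
    exact (ContinuousAt.comp (f := fun t : ℝ => p + t • e) h1 (by fun_prop)).continuousWithinAt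
  have hneg : ∀ t ∈ Icc 0 L, φ t = 0 → fderiv ℝ (fderiv ℝ u) (p + t • e) e e < 0 := fun t ht h0 =>
    h.fderiv_fderiv_axis_neg (hmem t ht) (hax t) h0
  obtain ⟨ε, ⟨hε0, hεL⟩, hφε⟩ : ∃ ε ∈ Ioo 0 L, φ ε < 0 := by
    have h1 := h.eventually_fderiv_pos (d := -e) (v := e) hp (by simp [hp0])
      (by simpa using hneg 0 ⟨le_rfl, hL0.le⟩ (by simp [hφ, hp0]))
    obtain ⟨ε, h2, h3⟩ := (h1.and (Ioo_mem_nhdsGT hL0)).exists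
    exact ⟨ε, h3, by simpa using h2⟩
  have hcpt : IsCompact (Icc ε L ∩ φ ⁻¹' Ici 0) :=
    isCompact_Icc.of_isClosed_subset ((hφc.mono
        (Icc_subset_Icc_left hε0.le)).preimage_isClosed_of_isClosed
      isClosed_Icc isClosed_Ici) inter_subset_left
  obtain ⟨c, ⟨⟨hcε, hcL⟩, hc0⟩, hcmin⟩ := hcpt.exists_isLeast ⟨L, ⟨hεL.le, le_rfl⟩, by
    simp [hφ, hqL, hq0]⟩
  have hc0' : 0 ≤ φ c := hc0
  have hcI : c ∈ Icc 0 L := ⟨hε0.le.trans hcε, hcL⟩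
  have hεc : ε < c := hcε.lt_of_ne (by rintro rfl; exact absurd hφε (not_lt.2 hc0'))
  have hleft : ∀ᶠ s in 𝓝[>] (0 : ℝ), 0 < fderiv ℝ u (p + c • e + s • (-e)) e := by
    rcases hc0'.eq_or_lt with hz | hpos
    · exact h.eventually_fderiv_pos (hmem c hcI) hz.symm (by simpa using hneg c hcI hz.symm)
    · have h1 := (h.analyticAt_fderiv_apply e (hmem c hcI)).continuousAt.eventually
        (lt_mem_nhds hpos)
      have h2 : ContinuousAt (fun s : ℝ => p + c • e + s • (-e)) 0 := by fun_prop
      exact (h2.eventually (by simpa using h1)).filter_mono nhdsWithin_le_nhds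
  obtain ⟨s, h1, h2s, h2c⟩ := (hleft.and (Ioo_mem_nhdsGT (sub_pos.2 hεc))).exists
  have h3 : p + c • e + s • (-e) = p + (c - s) • e := by module
  rw [h3] at h1
  have := hcmin ⟨⟨by linarith, by linarith⟩, h1.le⟩
  linarith

lemma eq_of_fderiv_eq_zero (h : IsAxialSolution k Ω f u) {p q : EuclideanSpace ℝ (Fin n)}
    (hp : p ∈ Ω) (hq : q ∈ Ω)
    (hp0 : fderiv ℝ u p = 0) (hq0 : fderiv ℝ u q = 0) : p = q := by
  have hk : p k = q k := le_antisymm (not_lt.1 (h.not_lt_of_fderiv_eq_zero hq hp hq0 hp0))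
    (not_lt.1 (h.not_lt_of_fderiv_eq_zero hp hq hp0 hq0))
  rw [h.eq_smul_single_of_fderiv_eq_zero hp hp0, h.eq_smul_single_of_fderiv_eq_zero hq hq0, hk]

lemma det_hessMatrix_ne_zero (h : IsAxialSolution k Ω f u) {p : EuclideanSpace ℝ (Fin n)}
    (hp : p ∈ Ω)
    (hp0 : fderiv ℝ u p = 0) : (hessMatrix u p).det ≠ 0 := by
  have hax := h.eq_smul_single_of_fderiv_eq_zero hp hp0
  have hdiag : hessMatrix u p = Matrix.diagonal fun i => hessEntry u p i i := by
    ext i j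
    rcases eq_or_ne i j with rfl | hij
    · simp [hessMatrix]
    · rw [Matrix.diagonal_apply_ne _ hij, hessMatrix, Matrix.of_apply, hessEntry_eq]
      exact h.fderiv_fderiv_single_eq_zero hp hax hij
  rw [hdiag, Matrix.det_diagonal, Finset.prod_ne_zero_iff]
  intro i _
  rw [hessEntry_eq]
  rcases eq_or_ne i k with rfl | hi
  · exact (h.fderiv_fderiv_axis_neg hp hax (by simp [hp0])).ne
  · exact h.fderiv_fderiv_single_ne_zero hp hax hi

end IsAxialSolution

end

/-- In a bounded, strictly convex, smooth, rotationally symmetric domain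
of `ℝⁿ` (`n ≥ 3`), a positive analytic solution of the mean curvature equation with zero
Dirichlet data has exactly one critical point, and it is nondegenerate. -/
theorem unique_nondegenerate_critical_point_higher_dim
    (n : ℕ) (hn : 3 ≤ n) (k : Fin n) (hk : (k : ℕ) = n - 1)
    (Ω : Set (EuclideanSpace ℝ (Fin n)))
    (hΩne : Ω.Nonempty) (hΩopen : IsOpen Ω) (hΩbd : Bornology.IsBounded Ω)
    (hΩconv : StrictConvex ℝ (closure Ω)) (hΩsmooth : HasSmoothBoundary Ω)
    (hΩsym : ∀ g : EuclideanSpace ℝ (Fin n) ≃ₗᵢ[ℝ] EuclideanSpace ℝ (Fin n),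
      IsAxisRotation k g → g '' Ω = Ω)
    (f : ℝ → ℝ) (hf : AnalyticOnNhd ℝ f Set.univ) (hfmono : Monotone f)
    (u : EuclideanSpace ℝ (Fin n) → ℝ)
    (hsol : IsMCSolution Ω f u) (hupos : ∀ x ∈ Ω, 0 < u x)
    (huan : AnalyticOnNhd ℝ u Ω)
    (huC1 : ContDiffOn ℝ 1 u (closure Ω)) :
    (∃! p : EuclideanSpace ℝ (Fin n), p ∈ Ω ∧ gradient u p = 0) ∧
      ∀ p ∈ Ω, gradient u p = 0 → (hessMatrix u p).det ≠ 0 := by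
  have h : IsAxialSolution k Ω f u :=
    ⟨hΩne, hΩopen, hΩbd, hΩconv, hΩsmooth, hΩsym, hf, hfmono, hsol, hupos, huan, huC1⟩
  have hgrad : ∀ p, gradient u p = 0 ↔ fderiv ℝ u p = 0 := fun p => by simp [gradient]
  obtain ⟨p, hp, hp0⟩ := h.exists_fderiv_eq_zero
  exact ⟨⟨p, ⟨hp, (hgrad p).2 hp0⟩,
      fun q hq => h.eq_of_fderiv_eq_zero hq.1 hp ((hgrad q).1 hq.2) hp0⟩,
    fun q hq hq0 => h.det_hessMatrix_ne_zero hq ((hgrad q).1 hq0)⟩
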